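/- arXiv:2104.02675 — 2 statements merged into one kernel-verified Lean document; each statement's English description precedes it below -/
import Mathlib

section
/- If W is a finite irreducible Coxeter group with Coxeter number h and f : W → W is compulsive, then f^{h−1}(w) = e for every w ∈ W; in particular, the forward orbit of every element under f has size at most h. -/
namespace CoxPop

variable {B W : Type*} [Group W] {M : CoxeterMatrix B} (cs : CoxeterSystem M W)

/-- The standard parabolic subgroup generated by the simple reflections indexed by `J`. -/
def parabolic (J : Set B) : Subgroup W :=
  Subgroup.closure (cs.simple '' J)

/-- The right descent set of `w`. -/
def D (w : W) : Set B := {i | cs.IsRightDescent w i}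

/-- `u` is a longest element of the standard parabolic subgroup `W_J`. -/
def IsLongestIn (J : Set B) (u : W) : Prop :=
  u ∈ parabolic cs J ∧ ∀ v ∈ parabolic cs J, cs.length v ≤ cs.length u

open Classical in
/-- The longest element `w₀(J)` of the standard parabolic subgroup `W_J`. -/
noncomputable def w0 (J : Set B) : W :=
  if h : ∃ u, IsLongestIn cs J u then h.choose else 1

/-- The Coxeter pop-stack-sorting operator: `Pop w = w * w₀(D_R(w))`. -/
noncomputable def Pop (w : W) : W := w * w0 cs (D cs w)

/-- The right weak order on `W`: `x ≤_R y` iff `ℓ(x) + ℓ(x⁻¹y) = ℓ(y)`. -/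
def rweakLE (x y : W) : Prop := cs.length x + cs.length (x⁻¹ * y) = cs.length y

/-- `u` is the minimal-length representative `ᴶw` of the right coset `W_J w`. -/
def IsMinRep (J : Set B) (w u : W) : Prop :=
  (∃ p ∈ parabolic cs J, u = p * w) ∧
    ∀ v : W, (∃ p ∈ parabolic cs J, v = p * w) → cs.length u ≤ cs.length v

/-- A map `f : W → W` is compulsive if `f(w) ≤_R w` and `f(w) ≤_R ws` for every
right descent `s` of `w`. -/
def Compulsive (f : W → W) : Prop :=
  ∀ w : W, rweakLE cs (f w) w ∧ ∀ i ∈ D cs w, rweakLE cs (f w) (w * cs.simple i)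

/-- The strong Bruhat order: `x ≤ y` iff some reduced word for `y` contains a
reduced word for `x` as a (not necessarily contiguous) subword. -/
def bruhatLE (x y : W) : Prop :=
  ∃ ω : List B, cs.wordProd ω = y ∧ ω.length = cs.length y ∧
    ∃ ω' : List B, ω'.Sublist ω ∧ cs.wordProd ω' = x ∧ ω'.length = cs.length x

/-- The Coxeter system is irreducible: its Coxeter diagram is connected, i.e. the
index set admits no nontrivial partition into two mutually commuting parts. -/
def IsIrreducibleMatrix {B : Type*} (M : CoxeterMatrix B) : Prop :=
  ∀ J : Set B, (∀ i ∈ J, ∀ j ∈ Jᶜ, M i j = 2) → J = ∅ ∨ J = Set.univ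

open CoxeterSystem

section

/-- The Cartan matrix of the geometric representation. -/
noncomputable def cartan (M : CoxeterMatrix B) (s t : B) : ℝ := -2 * Real.cos (Real.pi / M s t)

theorem cartan_comm (s t : B) : cartan M s t = cartan M t s := by
  rw [cartan, cartan, M.symmetric s t]

@[simp] theorem cartan_self (s : B) : cartan M s s = 2 := by simp [cartan]

theorem cartan_eq_zero_of_eq_two {s t : B} (h : M s t = 2) : cartan M s t = 0 := by
  simp [cartan, h]

theorem cartan_le_neg_one {s t : B} (hne : s ≠ t) (h : M s t ≠ 2) : cartan M s t ≤ -1 := by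
  have h1 : M s t ≠ 1 := M.off_diagonal s t hne
  have hle : Real.pi / M s t ≤ Real.pi / 3 := by
    rcases Nat.eq_zero_or_pos (M s t) with h0 | h0
    · rw [h0, Nat.cast_zero, div_zero]
      positivity
    · have : (3 : ℝ) ≤ M s t := by exact_mod_cast (by omega : 3 ≤ M s t)
      have := Real.pi_pos
      gcongr
  have := Real.cos_le_cos_of_nonneg_of_le_pi (by positivity) (by linarith [Real.pi_pos]) hle
  rw [Real.cos_pi_div_three] at this
  rw [cartan]
  linarith

theorem cartan_nonpos {s t : B} (hne : s ≠ t) : cartan M s t ≤ 0 := by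
  by_cases h : M s t = 2
  · rw [cartan_eq_zero_of_eq_two h]
  · linarith [cartan_le_neg_one hne h]

theorem eq_two_of_cartan_eq_zero {s t : B} (hne : s ≠ t) (h : cartan M s t = 0) : M s t = 2 := by
  by_contra h2
  linarith [cartan_le_neg_one hne h2]

/-- The Chebyshev-type sequence `0, 1, a, a² - 1, …`. -/
def chebSeq (a : ℝ) : ℕ → ℝ
  | 0 => 0
  | 1 => 1
  | n + 2 => a * chebSeq a (n + 1) - chebSeq a n

theorem chebSeq_cos_mul_sin (φ : ℝ) (n : ℕ) :
    chebSeq (2 * Real.cos φ) n * Real.sin φ = Real.sin (n * φ) ∧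
      chebSeq (2 * Real.cos φ) (n + 1) * Real.sin φ = Real.sin ((n + 1) * φ) := by
  induction n with
  | zero => simp [chebSeq]
  | succ n ih =>
    refine ⟨by simpa using ih.2, ?_⟩
    rw [chebSeq, sub_mul, ih.1, mul_assoc, ih.2]
    have h1 : ((n + 1 : ℕ) + 1 : ℝ) * φ = (n + 1) * φ + φ := by push_cast; ring
    have h2 : (n : ℝ) * φ = (n + 1) * φ - φ := by ring
    rw [h1, h2, Real.sin_add, Real.sin_sub]
    ring

theorem chebSeq_two (n : ℕ) : chebSeq 2 n = n ∧ chebSeq 2 (n + 1) = n + 1 := by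
  induction n with
  | zero => simp [chebSeq]
  | succ n ih =>
    refine ⟨by simpa using ih.2, ?_⟩
    rw [chebSeq, ih.1, ih.2]
    push_cast
    ring

theorem sin_pi_div_pos {m : ℕ} (hm : 2 ≤ m) : 0 < Real.sin (Real.pi / m) := by
  have h2 : (2 : ℝ) ≤ m := by exact_mod_cast hm
  have := Real.pi_pos
  refine Real.sin_pos_of_pos_of_lt_pi (by positivity) ?_
  rw [div_lt_iff₀ (by linarith)]
  nlinarith

theorem chebSeq_neg_cartan_nonneg {s t : B} (hne : s ≠ t) {n : ℕ} (hn : M s t = 0 ∨ n ≤ M s t) :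
    0 ≤ chebSeq (-cartan M s t) n := by
  have e : -cartan M s t = 2 * Real.cos (Real.pi / M s t) := by rw [cartan]; ring
  rw [e]
  by_cases h0 : M s t = 0
  · simp [h0, (chebSeq_two n).1]
  · have h2 : 2 ≤ M s t := by have := M.off_diagonal s t hne; omega
    have hn : n ≤ M s t := hn.resolve_left h0
    have hs := sin_pi_div_pos h2
    have hh := (chebSeq_cos_mul_sin (Real.pi / M s t) n).1
    have : 0 ≤ Real.sin (n * (Real.pi / M s t)) := by
      have := Real.pi_pos
      refine Real.sin_nonneg_of_nonneg_of_le_pi (by positivity) ?_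
      have h3 : (n : ℝ) ≤ M s t := by exact_mod_cast hn
      have h4 : (0 : ℝ) < M s t := by positivity
      rw [← mul_div_assoc, div_le_iff₀ h4]
      nlinarith
    rw [← hh] at this
    exact nonneg_of_mul_nonneg_left this hs

section

variable [DecidableEq B]

/-- The simple root `αₛ`. -/
def root (s : B) : B → ℝ := Pi.single s 1

@[simp] theorem root_same (s : B) : (root s : B → ℝ) s = 1 := by simp [root]

@[simp] theorem root_of_ne {s t : B} (h : t ≠ s) : (root s : B → ℝ) t = 0 := by simp [root, h]

end

variable [Fintype B]

/-- The simple coroot `αₛ^∨` as a linear functional. -/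
noncomputable def coroot (M : CoxeterMatrix B) (s : B) : (B → ℝ) →ₗ[ℝ] ℝ where
  toFun v := ∑ t, cartan M s t * v t
  map_add' v w := by simp [mul_add, Finset.sum_add_distrib]
  map_smul' a v := by simp [Finset.mul_sum, mul_left_comm]

theorem coroot_apply (s : B) (v : B → ℝ) : coroot M s v = ∑ t, cartan M s t * v t := rfl

variable [DecidableEq B]

@[simp] theorem coroot_root (s t : B) : coroot M s (root t) = cartan M s t := by
  simp [coroot_apply, root, Pi.single_apply]

/-- The simple reflection acting on the geometric representation. -/
noncomputable def refl (M : CoxeterMatrix B) (s : B) : Module.End ℝ (B → ℝ) :=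
  LinearMap.id - (coroot M s).smulRight (root s)

theorem refl_apply (s : B) (v : B → ℝ) : refl M s v = v - coroot M s v • root s := rfl

theorem refl_root (s t : B) : refl M s (root t) = root t - cartan M s t • root s := by
  rw [refl_apply, coroot_root]

theorem refl_apply_of_ne {s t : B} (h : t ≠ s) (v : B → ℝ) : refl M s v t = v t := by
  simp [refl_apply, h]

theorem refl_root_self (s : B) : refl M s (root s) = -root s := by
  rw [refl_root, cartan_self]; module

theorem refl_mul_self (s : B) : refl M s * refl M s = 1 := by
  refine LinearMap.ext fun v => ?_
  have h : coroot M s (refl M s v) = - coroot M s v := by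
    rw [refl_apply, map_sub, map_smul, coroot_root, cartan_self, smul_eq_mul]; ring
  rw [Module.End.mul_apply, refl_apply, h, refl_apply]
  simp

theorem prod_alternatingWord_root {s t : B} (n : ℕ) :
    ((CoxeterSystem.alternatingWord s t n).map (refl M)).prod (root s) =
      (if Even n then
        chebSeq (-cartan M s t) (n + 1) • root s + chebSeq (-cartan M s t) n • root t
      else chebSeq (-cartan M s t) n • root s + chebSeq (-cartan M s t) (n + 1) • root t) := by
  induction n with
  | zero => simp [CoxeterSystem.alternatingWord, chebSeq]
  | succ n ih =>
    rw [CoxeterSystem.alternatingWord_succ', List.map_cons, List.prod_cons, Module.End.mul_apply,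
      ih]
    by_cases h : Even n
    · have h' : ¬ Even (n + 1) := by simp [h, parity_simps]
      simp only [h, h', if_true, if_false, map_add, map_smul, refl_root, cartan_self, chebSeq,
        cartan_comm t s]
      module
    · have h' : Even (n + 1) := by simp [h, parity_simps]
      simp only [h, h', if_true, if_false, map_add, map_smul, refl_root, cartan_self, chebSeq]
      module

theorem refl_mul_pow_root (s t : B) (n : ℕ) : ((refl M s * refl M t) ^ n) (root s) =
    chebSeq (-cartan M s t) (2 * n + 1) • root s + chebSeq (-cartan M s t) (2 * n) • root t := by
  have h := prod_alternatingWord_root (M := M) (s := s) (t := t) (2 * n)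
  rw [if_pos (by simp)] at h
  rw [← h]
  congr 1
  clear h
  induction n with
  | zero => simp [CoxeterSystem.alternatingWord]
  | succ n ih =>
    rw [mul_add, mul_one, CoxeterSystem.alternatingWord_succ, CoxeterSystem.alternatingWord_succ,
      pow_succ, ih]
    simp

theorem refl_mul_pow_root_eq {s t : B} (hne : s ≠ t) (h0 : M s t ≠ 0) :
    ((refl M s * refl M t) ^ M s t) (root s) = root s := by
  have h2 : 2 ≤ M s t := by have := M.off_diagonal s t hne; omega
  have hs := sin_pi_div_pos h2
  have e : -cartan M s t = 2 * Real.cos (Real.pi / M s t) := by rw [cartan]; ring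
  have hm : (M s t : ℝ) ≠ 0 := by exact_mod_cast h0
  obtain ⟨ha, hb⟩ := chebSeq_cos_mul_sin (Real.pi / M s t) (2 * M s t)
  have e1 : ((2 * M s t : ℕ) : ℝ) * (Real.pi / M s t) = 2 * Real.pi := by
    push_cast; field_simp
  have e2 : (((2 * M s t : ℕ) : ℝ) + 1) * (Real.pi / M s t) = Real.pi / M s t + 2 * Real.pi := by
    push_cast; field_simp; ring
  rw [e1, Real.sin_two_pi] at ha
  rw [e2, Real.sin_add_two_pi] at hb
  rw [refl_mul_pow_root, e, (mul_eq_zero.1 ha).resolve_right hs.ne',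
    mul_right_cancel₀ hs.ne' (hb.trans (one_mul _).symm)]
  simp

theorem refl_mul_pow_inv (s t : B) (n : ℕ) :
    (refl M s * refl M t) ^ n * (refl M t * refl M s) ^ n = 1 := by
  have hc : refl M s * refl M t * (refl M t * refl M s) = 1 := by
    rw [mul_assoc, ← mul_assoc (refl M t), refl_mul_self, one_mul, refl_mul_self]
  induction n with
  | zero => simp
  | succ n ih =>
    rw [pow_succ, pow_succ', mul_assoc, ← mul_assoc (refl M s * refl M t), hc, one_mul, ih]

theorem refl_isLiftable : M.IsLiftable (refl M) := by
  intro s t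
  by_cases hne : s = t
  · subst hne; simp [refl_mul_self]
  by_cases h0 : M s t = 0
  · simp [h0]
  have h2 : 2 ≤ M s t := by have := M.off_diagonal s t hne; omega
  have hs := sin_pi_div_pos h2
  have hS := refl_mul_pow_root_eq hne h0
  have hT : ((refl M s * refl M t) ^ M s t) (root t) = root t := by
    have := refl_mul_pow_root_eq (M := M) (Ne.symm hne) (by rwa [M.symmetric t s])
    rw [M.symmetric t s] at this
    conv_lhs => rw [← this]
    rw [← Module.End.mul_apply, refl_mul_pow_inv]
    rfl
  refine LinearMap.ext fun v => ?_
  set a := cartan M s t with ha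
  have hdet : 4 - a ^ 2 ≠ 0 := by
    have : 4 - a ^ 2 = 4 * Real.sin (Real.pi / M s t) ^ 2 := by
      rw [ha, cartan, Real.sin_sq]; ring
    rw [this]; positivity
  set x := (2 * coroot M s v - a * coroot M t v) / (4 - a ^ 2) with hx
  set y := (2 * coroot M t v - a * coroot M s v) / (4 - a ^ 2) with hy
  set v0 := v - x • root s - y • root t with hv0
  have hs0 : refl M s v0 = v0 := by
    have : coroot M s v0 = 0 := by
      simp only [hv0, map_sub, map_smul, coroot_root, cartan_self, smul_eq_mul, ← ha]
      rw [hx, hy]; field_simp; ring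
    rw [refl_apply, this]; simp
  have ht0 : refl M t v0 = v0 := by
    have : coroot M t v0 = 0 := by
      simp only [hv0, map_sub, map_smul, coroot_root, cartan_self, smul_eq_mul, cartan_comm t s,
        ← ha]
      rw [hx, hy]; field_simp; ring
    rw [refl_apply, this]; simp
  have h0' : ∀ n : ℕ, ((refl M s * refl M t) ^ n) v0 = v0 := by
    intro n
    induction n with
    | zero => simp
    | succ n ih => rw [pow_succ, Module.End.mul_apply, Module.End.mul_apply, ht0, hs0, ih]
  have hv : v = v0 + x • root s + y • root t := by rw [hv0]; module
  rw [hv, map_add, map_add, map_smul, map_smul, hS, hT, h0']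
  rfl

/-- The geometric representation of a Coxeter group. -/
noncomputable def geomRep : W →* Module.End ℝ (B → ℝ) := cs.lift ⟨refl M, refl_isLiftable⟩

@[simp] theorem geomRep_simple (s : B) : geomRep cs (cs.simple s) = refl M s :=
  cs.lift_apply_simple refl_isLiftable s

theorem geomRep_wordProd (ω : List B) : geomRep cs (cs.wordProd ω) = (ω.map (refl M)).prod := by
  simp [CoxeterSystem.wordProd, map_list_prod, Function.comp_def]

end

section

theorem exists_maximal_alternating_suffix {w : W} {s t : B} (ht : cs.IsRightDescent w t) :
    ∃ (v : W) (k : ℕ), w = v * cs.wordProd (alternatingWord s t k) ∧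
      cs.length w = cs.length v + k ∧ 0 < k ∧ ¬ cs.IsRightDescent v s ∧
      ¬ cs.IsRightDescent v t := by
  classical
  let P : ℕ → Prop := fun k => ∃ v : W, w = v * cs.wordProd (alternatingWord s t k) ∧
    cs.length w = cs.length v + k
  have hP1 : P 1 := by
    refine ⟨w * cs.simple t, by simp [alternatingWord], ?_⟩
    have := cs.isRightDescent_iff.1 ht
    omega
  have hbound : ∀ k, P k → k ≤ cs.length w := by rintro k ⟨v, -, h⟩; omega
  set k := Nat.findGreatest P (cs.length w) with hk
  have hkP : P k := Nat.findGreatest_spec (hbound 1 hP1) hP1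
  have hk1 : 1 ≤ k := Nat.le_findGreatest (hbound 1 hP1) hP1
  obtain ⟨v, hv, hlen⟩ := hkP
  -- The letter that would lengthen the suffix is not a descent of `v`.
  have hnext : ¬ cs.IsRightDescent v (if Even k then t else s) := by
    intro hd
    have hd := cs.isRightDescent_iff.1 hd
    have : P (k + 1) := by
      refine ⟨v * cs.simple (if Even k then t else s), ?_, by omega⟩
      rw [alternatingWord_succ', wordProd_cons, mul_assoc, simple_mul_simple_cancel_left, ← hv]
    have := Nat.le_findGreatest (hbound _ this) this
    omega
  -- The first letter of the suffix is not a descent of `v`, as the lengths add up.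
  have hfirst : ¬ cs.IsRightDescent v (if Even (k - 1) then t else s) := by
    intro hd
    have hd := cs.isRightDescent_iff.1 hd
    obtain ⟨j, hj⟩ : ∃ j, k = j + 1 := ⟨k - 1, by omega⟩
    rw [hj, Nat.add_sub_cancel] at hd
    have e : w = v * cs.simple (if Even j then t else s) *
        cs.wordProd (alternatingWord s t j) := by
      rw [hv, hj, alternatingWord_succ', wordProd_cons, mul_assoc]
    have h1 := cs.length_mul_le (v * cs.simple (if Even j then t else s))
      (cs.wordProd (alternatingWord s t j))
    have h2 := cs.length_wordProd_le (alternatingWord s t j)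
    rw [← e] at h1
    rw [length_alternatingWord] at h2
    omega
  refine ⟨v, k, hv, hlen, hk1, ?_⟩
  obtain ⟨j, hj⟩ : ∃ j, k = j + 1 := ⟨k - 1, by omega⟩
  clear_value k
  subst hj
  by_cases he : Even j
  · simp [he, parity_simps] at hnext hfirst
    exact ⟨hnext, hfirst⟩
  · simp [he, parity_simps] at hnext hfirst
    exact ⟨hfirst, hnext⟩

theorem alternating_suffix_lt {w v : W} {s t : B} {k : ℕ}
    (hv : w = v * cs.wordProd (alternatingWord s t k)) (hlen : cs.length w = cs.length v + k)
    (hs : ¬ cs.IsRightDescent w s) : M s t = 0 ∨ k + 1 ≤ M s t := by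
  by_contra! hcon
  obtain ⟨h0, hk⟩ := hcon
  have hred : cs.IsReduced (alternatingWord s t k) := by
    have h1 := cs.length_mul_le v (cs.wordProd (alternatingWord s t k))
    have h2 := cs.length_wordProd_le (alternatingWord s t k)
    rw [← hv] at h1
    unfold CoxeterSystem.IsReduced
    rw [length_alternatingWord] at *
    omega
  have hkM : k = M s t := by
    by_contra hne
    exact cs.not_isReduced_alternatingWord s t h0 (by omega) hred
  obtain ⟨j, hj⟩ : ∃ j, M s t = j + 1 := ⟨M s t - 1, by omega⟩
  have hbraid := cs.wordProd_braidWord_eq s t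
  rw [braidWord, braidWord, M.symmetric t s, hj, alternatingWord_succ t s, wordProd_concat]
    at hbraid
  have e : w * cs.simple s = v * cs.wordProd (alternatingWord s t j) := by
    rw [hv, hkM, hj, hbraid, mul_assoc, mul_assoc, simple_mul_simple_self, mul_one]
  have h1 := cs.length_mul_le v (cs.wordProd (alternatingWord s t j))
  have h2 := cs.length_wordProd_le (alternatingWord s t j)
  rw [← e] at h1
  rw [length_alternatingWord] at h2
  have := cs.not_isRightDescent_iff.1 hs
  omega

variable [Fintype B]

/-- The symmetric bilinear form of the geometric representation. -/
noncomputable def form (M : CoxeterMatrix B) (x y : B → ℝ) : ℝ := ∑ s, x s * coroot M s y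

theorem form_comm (x y : B → ℝ) : form M x y = form M y x := by
  simp only [form, coroot_apply, Finset.mul_sum]
  rw [Finset.sum_comm]
  refine Finset.sum_congr rfl fun s _ => Finset.sum_congr rfl fun t _ => ?_
  rw [cartan_comm]; ring

variable [DecidableEq B]

theorem geomRep_nonneg_combination {v : W} {s t : B} {a b : ℝ} (ha : 0 ≤ a) (hb : 0 ≤ b)
    (hs : 0 ≤ geomRep cs v (root s)) (ht : 0 ≤ geomRep cs v (root t)) :
    0 ≤ geomRep cs v (a • root s + b • root t) := by
  rw [map_add, map_smul, map_smul]
  positivity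

theorem geomRep_root_nonneg {w : W} {s : B} (hs : ¬ cs.IsRightDescent w s) :
    0 ≤ geomRep cs w (root s) := by
  induction hn : cs.length w using Nat.strong_induction_on generalizing w s with
  | _ n ih =>
    subst hn
    by_cases hw : w = 1
    · subst hw
      rw [map_one, Module.End.one_apply]
      intro t
      by_cases h : t = s
      · subst h; simp
      · simp [h]
    obtain ⟨t, ht⟩ := cs.exists_rightDescent_of_ne_one hw
    have hne : s ≠ t := by rintro rfl; exact hs ht
    obtain ⟨v, k, hv, hlen, hk, hvs, hvt⟩ := exists_maximal_alternating_suffix cs (s := s) ht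
    have hkM := alternating_suffix_lt cs hv hlen hs
    have h1 := ih (cs.length v) (by omega) hvs rfl
    have h2 := ih (cs.length v) (by omega) hvt rfl
    rw [hv, map_mul, Module.End.mul_apply, geomRep_wordProd, prod_alternatingWord_root]
    have hc1 := chebSeq_neg_cartan_nonneg hne hkM
    have hc2 : 0 ≤ chebSeq (-cartan M s t) k :=
      chebSeq_neg_cartan_nonneg hne (hkM.imp id fun h => by omega)
    split_ifs
    · exact geomRep_nonneg_combination cs hc1 hc2 h1 h2
    · exact geomRep_nonneg_combination cs hc2 hc1 h1 h2

theorem geomRep_mul_simple_root (w : W) (s : B) :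
    geomRep cs (w * cs.simple s) (root s) = - geomRep cs w (root s) := by
  rw [map_mul, Module.End.mul_apply, geomRep_simple, refl_root_self, map_neg]

theorem geomRep_root_nonpos {w : W} {s : B} (hs : cs.IsRightDescent w s) :
    geomRep cs w (root s) ≤ 0 := by
  have h := geomRep_root_nonneg cs (cs.isRightDescent_iff_not_isRightDescent_mul.1 hs)
  rw [geomRep_mul_simple_root] at h
  exact neg_nonneg.1 h

theorem geomRep_inv_apply (w : W) (v : B → ℝ) : geomRep cs w⁻¹ (geomRep cs w v) = v := by
  rw [← Module.End.mul_apply, ← map_mul, inv_mul_cancel, map_one, Module.End.one_apply]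

theorem geomRep_root_ne_zero (w : W) (s : B) : geomRep cs w (root s) ≠ 0 := by
  intro h
  have h1 := geomRep_inv_apply cs w (root s)
  rw [h, map_zero] at h1
  simpa using congrFun h1 s

theorem isRightDescent_iff_root_nonpos {w : W} {s : B} :
    cs.IsRightDescent w s ↔ geomRep cs w (root s) ≤ 0 := by
  refine ⟨geomRep_root_nonpos cs, fun h => ?_⟩
  by_contra hs
  exact geomRep_root_ne_zero cs w s (le_antisymm h (geomRep_root_nonneg cs hs))

theorem geomRep_injective : Function.Injective (geomRep cs) := by
  rw [injective_iff_map_eq_one']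
  refine fun w => ⟨fun h => ?_, fun h => by rw [h, map_one]⟩
  by_contra hw
  obtain ⟨s, hs⟩ := cs.exists_rightDescent_of_ne_one hw
  have := geomRep_root_nonpos cs hs s
  rw [h, Module.End.one_apply, root_same] at this
  exact absurd this (by norm_num)

theorem form_root_left (s : B) (y : B → ℝ) : form M (root s) y = coroot M s y := by
  simp [form, root, Pi.single_apply]

theorem form_refl_left (s : B) (x y : B → ℝ) :
    form M (refl M s x) y = form M x y - coroot M s x * coroot M s y := by
  simp only [form, refl_apply, Pi.sub_apply, Pi.smul_apply, smul_eq_mul, sub_mul,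
    Finset.sum_sub_distrib]
  simp [root, Pi.single_apply]

theorem form_refl_refl (s : B) (x y : B → ℝ) :
    form M (refl M s x) (refl M s y) = form M x y := by
  have h : coroot M s (refl M s y) = - coroot M s y := by
    rw [refl_apply, map_sub, map_smul, coroot_root, cartan_self, smul_eq_mul]; ring
  rw [form_refl_left, h, form_comm x, form_refl_left, form_comm y]
  ring

theorem form_geomRep (w : W) (x y : B → ℝ) :
    form M (geomRep cs w x) (geomRep cs w y) = form M x y := by
  induction w using cs.simple_induction_left generalizing x y with
  | one => simp
  | mul_simple_left w s ih =>
    rw [map_mul, Module.End.mul_apply, Module.End.mul_apply, geomRep_simple, form_refl_refl, ih]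

/-- If `v` carries the simple root `αₛ` to a multiple of `αᵣ`, it conjugates `s` to `r`. -/
theorem simple_mul_mul_simple_eq {v : W} {r s : B} {a : ℝ}
    (h : geomRep cs v (root s) = a • root r) : cs.simple r * v * cs.simple s = v := by
  have ha : a * a = 1 := by
    have h1 := form_geomRep cs v (root s) (root s)
    rw [h, form_root_left, coroot_root, cartan_self] at h1
    have h2 : form M (a • root r) (a • root r) = a * (a * 2) := by
      rw [← cartan_self (M := M) r, ← coroot_root, ← form_root_left]
      simp only [form, map_smul, Pi.smul_apply, smul_eq_mul, Finset.mul_sum]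
      exact Finset.sum_congr rfl fun _ _ => by ring
    linarith
  have key : v * cs.simple s = cs.simple r * v := by
    apply geomRep_injective cs
    refine LinearMap.ext fun x => ?_
    rw [map_mul, map_mul, Module.End.mul_apply, Module.End.mul_apply, geomRep_simple,
      geomRep_simple, refl_apply, refl_apply, map_sub, map_smul, h, ← form_root_left,
      ← form_root_left, ← form_geomRep cs v (root s), h]
    have : form M (a • root r) (geomRep cs v x) = a * form M (root r) (geomRep cs v x) := by
      simp only [form, Pi.smul_apply, smul_eq_mul, Finset.mul_sum]
      exact Finset.sum_congr rfl fun _ _ => by ring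
    rw [this, smul_smul, mul_right_comm, ha, one_mul]
  rw [mul_assoc, key, simple_mul_simple_cancel_left]

/-- The exchange condition for arbitrary words. -/
theorem exists_sublist_of_isRightDescent {ω : List B} {s : B}
    (h : cs.IsRightDescent (cs.wordProd ω) s) :
    ∃ τ : List B, τ.Sublist ω ∧ cs.wordProd τ = cs.wordProd ω * cs.simple s := by
  induction ω with
  | nil => exact absurd h (by simpa using cs.not_isRightDescent_one s)
  | cons r ω ih =>
    by_cases hs : cs.IsRightDescent (cs.wordProd ω) s
    · obtain ⟨τ, hτ, e⟩ := ih hs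
      exact ⟨r :: τ, hτ.cons_cons r, by rw [wordProd_cons, wordProd_cons, e, mul_assoc]⟩
    · have h1 := geomRep_root_nonneg cs hs
      have h2 := geomRep_root_nonpos cs h
      rw [wordProd_cons, map_mul, Module.End.mul_apply, geomRep_simple] at h2
      have h3 : geomRep cs (cs.wordProd ω) (root s) =
          (geomRep cs (cs.wordProd ω) (root s) r) • root r := by
        ext t
        by_cases ht : t = r
        · subst ht; simp
        · have := h2 t
          rw [refl_apply_of_ne ht] at this
          simpa [ht] using le_antisymm this (h1 t)
      refine ⟨ω, List.sublist_cons_self r ω, ?_⟩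
      rw [wordProd_cons, simple_mul_mul_simple_eq cs h3]

end

section

/-- The Coxeter diagram as a simple graph. -/
def diagram (M : CoxeterMatrix B) : SimpleGraph B where
  Adj s t := s ≠ t ∧ M s t ≠ 2
  symm := ⟨fun s t h => ⟨h.1.symm, by rw [M.symmetric t s]; exact h.2⟩⟩
  loopless := ⟨fun _ h => h.1 rfl⟩

theorem cartan_eq_zero_of_not_adj {s t : B} (hne : s ≠ t) (h : ¬ (diagram M).Adj s t) :
    cartan M s t = 0 := by
  apply cartan_eq_zero_of_eq_two
  by_contra h2
  exact h ⟨hne, h2⟩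

theorem diagram_connected [Nonempty B] (hirr : IsIrreducibleMatrix M) :
    (diagram M).Connected := by
  refine ⟨fun s t => ?_⟩
  have hJ := hirr {r | (diagram M).Reachable s r} fun i hi j hj => by
    by_contra h2
    refine hj (SimpleGraph.Reachable.trans hi (SimpleGraph.Adj.reachable ⟨?_, h2⟩))
    rintro rfl
    exact hj hi
  rcases hJ with h | h
  · exact absurd (SimpleGraph.Reachable.refl s) (Set.eq_empty_iff_forall_notMem.1 h s)
  · exact Set.eq_univ_iff_forall.1 h t

theorem exists_potential {V : Type*} {G : SimpleGraph V} (hG : G.IsTree) (d : V → V → ℤ)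
    (hd : ∀ u v, d v u = -d u v) : ∃ η : V → ℤ, ∀ u v, G.Adj u v → η v = η u + d u v := by
  obtain ⟨r⟩ := hG.connected.nonempty
  choose p hp using fun v => (hG.existsUnique_path r v).exists
  refine ⟨fun v => ((p v).darts.map fun e => d e.fst e.snd).sum, fun u v h => ?_⟩
  by_cases hu : u ∈ (p v).support
  · simp [hG.isAcyclic.path_concat (hp u) (hp v) h hu, SimpleGraph.Walk.darts_concat]
  · have hv := hG.isAcyclic.mem_support_of_ne_mem_support_of_adj_of_isPath (hp u) (hp v) h hu
    simp [hG.isAcyclic.path_concat (hp v) (hp u) h.symm hv, SimpleGraph.Walk.darts_concat,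
      hd u v]

variable [Fintype B]

section
variable [DecidableEq B]

theorem sum_smul_root (x : B → ℝ) : ∑ s, x s • root s = x := by
  ext t
  simp [Finset.sum_apply, root, Pi.single_apply]

theorem form_self_pos [Finite W] (cs : CoxeterSystem M W) (hirr : IsIrreducibleMatrix M)
    {x : B → ℝ} (hx : x ≠ 0) :
    0 < form M x x := by
  have := Fintype.ofFinite W
  let G : (B → ℝ) → (B → ℝ) → ℝ := fun x y => ∑ w : W, geomRep cs w x ⬝ᵥ geomRep cs w y
  have hcomm : ∀ x y, G x y = G y x := fun x y =>
    Finset.sum_congr rfl fun w _ => dotProduct_comm _ _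
  have hinv : ∀ s x y, G (refl M s x) (refl M s y) = G x y := by
    intro s x y
    refine Fintype.sum_equiv (Equiv.mulRight (cs.simple s)) _ _ fun w => ?_
    simp [map_mul]
  have hpos : ∀ x, x ≠ 0 → 0 < G x x := by
    intro x hx
    refine Finset.sum_pos' (fun w _ => ?_) ⟨1, Finset.mem_univ _, ?_⟩
    · exact Finset.sum_nonneg fun s _ => mul_self_nonneg _
    · obtain ⟨s, hs⟩ := Function.ne_iff.1 hx
      rw [map_one, Module.End.one_apply]
      exact Finset.sum_pos' (fun s _ => mul_self_nonneg _)
        ⟨s, Finset.mem_univ _, mul_self_pos.2 hs⟩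
  have hroot : ∀ s x, 2 * G x (root s) = coroot M s x * G (root s) (root s) := by
    intro s x
    have h := hinv s x (root s)
    rw [refl_root_self, refl_apply] at h
    simp only [G, map_sub, map_neg, map_smul, sub_dotProduct, smul_dotProduct, dotProduct_neg,
      smul_eq_mul, Finset.sum_neg_distrib, Finset.sum_sub_distrib, ← Finset.mul_sum] at h ⊢
    linarith
  have hg0 : ∀ s, 0 < G (root s) (root s) := fun s => hpos _ fun h => by
    simpa using congrFun h s
  obtain ⟨s₀, -⟩ := Function.ne_iff.1 hx
  have hconst : ∀ s, G (root s) (root s) = G (root s₀) (root s₀) := by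
    have hJ := hirr {r | G (root r) (root r) = G (root s₀) (root s₀)} fun i hi j hj => by
      have hne : i ≠ j := by rintro rfl; exact hj hi
      refine eq_two_of_cartan_eq_zero hne ?_
      by_contra hc
      apply hj
      have h1 := hroot i (root j)
      have h2 := hroot j (root i)
      rw [coroot_root] at h1 h2
      rw [hcomm, h2, cartan_comm j i] at h1
      exact (mul_left_cancel₀ hc h1).trans hi
    rcases hJ with h | h
    · exact absurd rfl (Set.eq_empty_iff_forall_notMem.1 h s₀)
    · exact Set.eq_univ_iff_forall.1 h
  have hG : 2 * G x x = form M x x * G (root s₀) (root s₀) := by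
    have e : G x x = ∑ s, x s * G x (root s) := by
      have : G x x = G x (∑ s, x s • root s) := by rw [sum_smul_root]
      rw [this]
      simp only [G, map_sum, map_smul, dotProduct_sum, dotProduct_smul, smul_eq_mul,
        Finset.mul_sum]
      rw [Finset.sum_comm]
    rw [e, form, Finset.mul_sum, Finset.sum_mul]
    refine Finset.sum_congr rfl fun s _ => ?_
    rw [mul_left_comm, hroot, hconst, mul_assoc]
  have := hpos x hx
  exact pos_of_mul_pos_left (by linarith) (hg0 s₀).le

end

theorem diagram_isTree [Nonempty B] (hirr : IsIrreducibleMatrix M)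
    (hpos : 0 < form M (1 : B → ℝ) 1) : (diagram M).IsTree := by
  classical
  rw [SimpleGraph.isTree_iff_connected_and_card]
  have hconn := diagram_connected hirr
  refine ⟨hconn, le_antisymm ?_ hconn.card_vert_le_card_edgeSet_add_one⟩
  have hrow : ∀ s, coroot M s 1 ≤ 2 - (diagram M).degree s := by
    intro s
    rw [coroot_apply, ← Finset.add_sum_erase _ _ (Finset.mem_univ s), cartan_self]
    have : ∑ t ∈ Finset.univ.erase s, cartan M s t * (1 : B → ℝ) t ≤
        ∑ t ∈ Finset.univ.erase s, if (diagram M).Adj s t then (-1 : ℝ) else 0 := by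
      refine Finset.sum_le_sum fun t ht => ?_
      have hne : s ≠ t := (Finset.ne_of_mem_erase ht).symm
      split_ifs with h
      · simpa using cartan_le_neg_one h.1 h.2
      · simpa using cartan_nonpos hne
    rw [← Finset.sum_filter, Finset.sum_const] at this
    have hcard : (Finset.univ.erase s).filter ((diagram M).Adj s) =
        (diagram M).neighborFinset s := by
      ext t
      simp only [Finset.mem_filter, Finset.mem_erase, Finset.mem_univ, and_true,
        SimpleGraph.mem_neighborFinset, and_iff_right_iff_imp]
      exact fun h => h.ne'
    rw [hcard, SimpleGraph.card_neighborFinset_eq_degree] at this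
    simp at this ⊢
    linarith
  have h1 : form M (1 : B → ℝ) 1 ≤ ∑ s, (2 - (diagram M).degree s : ℝ) := by
    rw [form]
    exact Finset.sum_le_sum fun s _ => by simpa using hrow s
  have h2 : ∑ s, ((diagram M).degree s : ℝ) = 2 * (diagram M).edgeFinset.card := by
    exact_mod_cast (diagram M).sum_degrees_eq_twice_card_edges
  rw [Finset.sum_sub_distrib, h2] at h1
  simp at h1
  have h3 : ((diagram M).edgeFinset.card : ℝ) < Fintype.card B := by linarith
  have h4 : (diagram M).edgeFinset.card < Fintype.card B := by exact_mod_cast h3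
  rw [Nat.card_eq_fintype_card, Nat.card_eq_fintype_card, ← SimpleGraph.edgeFinset_card]
  omega

end

section

variable [Fintype B]

theorem form_add_smul (x v : B → ℝ) (t : ℝ) :
    form M (x + t • v) (x + t • v) = form M x x + 2 * t * form M v x + t ^ 2 * form M v v := by
  have h : form M (x + t • v) (x + t • v) =
      form M x x + t * form M x v + t * form M v x + t ^ 2 * form M v v := by
    simp only [form, Pi.add_apply, Pi.smul_apply, smul_eq_mul, map_add, map_smul, Finset.mul_sum,
      ← Finset.sum_add_distrib]
    exact Finset.sum_congr rfl fun _ _ => by ring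
  rw [h, form_comm x v]; ring

theorem form_abs_le (x : B → ℝ) : form M |x| |x| ≤ form M x x := by
  classical
  simp only [form, coroot_apply, Finset.mul_sum, Pi.abs_apply]
  refine Finset.sum_le_sum fun s _ => Finset.sum_le_sum fun t _ => ?_
  by_cases h : s = t
  · subst h
    have := abs_mul_abs_self (x s)
    rw [cartan_self]
    nlinarith
  · have h1 := cartan_nonpos (M := M) h
    have h2 : x s * x t ≤ |x s| * |x t| := by rw [← abs_mul]; exact le_abs_self _
    nlinarith

theorem continuous_form : Continuous fun x : B → ℝ => form M x x := by
  simp only [form, coroot_apply]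
  fun_prop

theorem isCompact_dotProduct_self_eq_one : IsCompact {x : B → ℝ | x ⬝ᵥ x = 1} := by
  refine Metric.isCompact_of_isClosed_isBounded ?_ ?_
  · exact isClosed_eq (by simp only [dotProduct]; fun_prop) continuous_const
  · refine (Metric.isBounded_closedBall (x := (0 : B → ℝ)) (r := 1)).subset fun x hx => ?_
    rw [mem_closedBall_zero_iff, pi_norm_le_iff_of_nonneg zero_le_one]
    intro s
    have h1 : x s * x s ≤ x ⬝ᵥ x :=
      Finset.single_le_sum (f := fun s => x s * x s) (fun s _ => mul_self_nonneg _)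
        (Finset.mem_univ s)
    rw [show x ⬝ᵥ x = 1 from hx] at h1
    exact abs_le_one_iff_mul_self_le_one.2 h1

theorem exists_nonneg_minimizer [Nonempty B] (M : CoxeterMatrix B) :
    ∃ p : B → ℝ, 0 ≤ p ∧ p ⬝ᵥ p = 1 ∧ ∀ x : B → ℝ, form M p p * (x ⬝ᵥ x) ≤ form M x x := by
  classical
  obtain ⟨s₀⟩ := ‹Nonempty B›
  have hne : {x : B → ℝ | x ⬝ᵥ x = 1}.Nonempty := ⟨root s₀, by simp [root]⟩
  obtain ⟨x, hx, hmin⟩ := isCompact_dotProduct_self_eq_one.exists_isMinOn hne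
    (continuous_form (M := M)).continuousOn
  have habs : |x| ⬝ᵥ |x| = 1 := by
    rw [← show x ⬝ᵥ x = 1 from hx]
    exact Finset.sum_congr rfl fun s _ => abs_mul_abs_self _
  refine ⟨|x|, abs_nonneg x, habs, fun y => ?_⟩
  by_cases hy : y = 0
  · simp [hy, form]
  have hyy : 0 < y ⬝ᵥ y := by
    obtain ⟨s, hs⟩ := Function.ne_iff.1 hy
    exact Finset.sum_pos' (fun s _ => mul_self_nonneg _) ⟨s, Finset.mem_univ _, mul_self_pos.2 hs⟩
  have hc : (√(y ⬝ᵥ y))⁻¹ * (√(y ⬝ᵥ y))⁻¹ * (y ⬝ᵥ y) = 1 := by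
    rw [← mul_inv, Real.mul_self_sqrt hyy.le, inv_mul_cancel₀ hyy.ne']
  set c := (√(y ⬝ᵥ y))⁻¹
  have h1 : form M x x ≤ form M (c • y) (c • y) := hmin (by
    simp only [Set.mem_ofPred_eq, smul_dotProduct, dotProduct_smul, smul_eq_mul]; linarith)
  have h2 : form M (c • y) (c • y) = c * c * form M y y := by
    simp only [form, map_smul, Pi.smul_apply, smul_eq_mul, Finset.mul_sum]
    exact Finset.sum_congr rfl fun _ _ => by ring
  have h3 := form_abs_le (M := M) x
  calc form M |x| |x| * (y ⬝ᵥ y) ≤ (c * c * form M y y) * (y ⬝ᵥ y) := by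
        gcongr; linarith
    _ = (c * c * (y ⬝ᵥ y)) * form M y y := by ring
    _ = form M y y := by rw [hc, one_mul]

theorem eq_zero_of_forall_quadratic_nonneg {a b : ℝ} (h : ∀ t : ℝ, 0 ≤ 2 * t * a + t ^ 2 * b) :
    a = 0 := by
  by_contra ha
  have h1 := h (-a / (|b| + 1))
  have hb : 0 < |b| + 1 := by positivity
  have h2 : 2 * (-a / (|b| + 1)) * a + (-a / (|b| + 1)) ^ 2 * b =
      a ^ 2 / (|b| + 1) ^ 2 * (b - 2 * (|b| + 1)) := by
    field_simp
    ring
  rw [h2] at h1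
  have h3 : 0 < a ^ 2 / (|b| + 1) ^ 2 := by positivity
  have := le_abs_self b
  have := abs_nonneg b
  nlinarith

/-- A strictly positive eigenvector of the Cartan matrix, with eigenvalue written as
`2 - 2 cos θ`. -/
theorem exists_perron [Nonempty B] (hirr : IsIrreducibleMatrix M)
    (hpos : ∀ x : B → ℝ, x ≠ 0 → 0 < form M x x) :
    ∃ (p : B → ℝ) (θ : ℝ), 0 < θ ∧ θ ≤ Real.pi / 2 ∧ (∀ s, 0 < p s) ∧
      ∀ s, coroot M s p = (2 - 2 * Real.cos θ) * p s := by
  classical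
  obtain ⟨p, hp0, hp1, hmin⟩ := exists_nonneg_minimizer M
  set κ := form M p p with hκ
  have hpne : p ≠ 0 := by rintro rfl; simp at hp1
  have hκ0 : 0 < κ := hpos p hpne
  have heig : ∀ s, coroot M s p = κ * p s := by
    intro s
    have : coroot M s p - κ * p s = 0 := by
      refine eq_zero_of_forall_quadratic_nonneg (b := form M (root s) (root s) - κ) fun t => ?_
      have h1 := hmin (p + t • root s)
      have h2 : (p + t • root s) ⬝ᵥ (p + t • root s) = 1 + 2 * t * p s + t ^ 2 := by
        simp only [add_dotProduct, dotProduct_add, smul_dotProduct, dotProduct_smul, hp1]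
        simp [root]
        ring
      rw [h2, form_add_smul, form_root_left s p, ← hκ] at h1
      linarith
    linarith
  have hppos : ∀ s, 0 < p s := by
    have hJ := hirr {s | p s = 0} fun i hi j hj => by
      have hne : i ≠ j := by rintro rfl; exact hj hi
      refine eq_two_of_cartan_eq_zero hne ?_
      have h1 := heig i
      rw [show p i = 0 from hi, mul_zero, coroot_apply] at h1
      have h2 := (Finset.sum_eq_zero_iff_of_nonpos fun t _ => ?_).1 h1 j (Finset.mem_univ j)
      · exact (mul_eq_zero.1 h2).resolve_right hj
      · by_cases ht : i = t
        · subst ht; rw [show p i = 0 from hi, mul_zero]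
        · exact mul_nonpos_of_nonpos_of_nonneg (cartan_nonpos ht) (hp0 t)
    rcases hJ with h | h
    · exact fun s => lt_of_le_of_ne (hp0 s)
        (Ne.symm (Set.eq_empty_iff_forall_notMem.1 h s))
    · exact absurd (funext (Set.eq_univ_iff_forall.1 h)) hpne
  obtain ⟨s₀⟩ := ‹Nonempty B›
  have hκ2 : κ ≤ 2 := by
    have h1 := heig s₀
    rw [coroot_apply, ← Finset.add_sum_erase _ _ (Finset.mem_univ s₀), cartan_self] at h1
    have h2 : ∑ t ∈ Finset.univ.erase s₀, cartan M s₀ t * p t ≤ 0 :=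
      Finset.sum_nonpos fun t ht => mul_nonpos_of_nonpos_of_nonneg
        (cartan_nonpos (Finset.ne_of_mem_erase ht).symm) (hp0 t)
    have := hppos s₀
    nlinarith
  refine ⟨p, Real.arccos (1 - κ / 2), Real.arccos_pos.2 (by linarith),
    Real.arccos_le_pi_div_two.2 (by linarith), hppos, fun s => ?_⟩
  rw [Real.cos_arccos (by linarith) (by linarith), heig]
  ring

end

section

variable [Fintype B]

/-- The letters whose colour has the parity of `k`. -/
noncomputable def block (χ : B → ℤ) (k : ℕ) : List B :=
  (Finset.univ.filter fun s => Even (χ s + k)).toList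

theorem mem_block {χ : B → ℤ} {k : ℕ} {s : B} : s ∈ block χ k ↔ Even (χ s + k) := by
  simp [block]

theorem nodup_block (χ : B → ℤ) (k : ℕ) : (block χ k).Nodup := Finset.nodup_toList _

/-- The concatenation of the first `k` blocks, with alternating colours. -/
noncomputable def blockWord (χ : B → ℤ) : ℕ → List B
  | 0 => []
  | k + 1 => blockWord χ k ++ block χ (k + 1)

/-- The covector obtained after `k` blocks. -/
noncomputable def blockCovector (χ : B → ℤ) (p : B → ℝ) (g : ℕ → ℝ) (k : ℕ) (s : B) : ℝ :=
  p s * if Even (χ s + (k + 1 : ℕ)) then g (k + 1) else -g k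

variable [DecidableEq B]

theorem dotProduct_refl (s : B) (x v : B → ℝ) :
    x ⬝ᵥ refl M s v = (x - x s • cartan M s) ⬝ᵥ v := by
  have h : x ⬝ᵥ root s = x s := by simp [root]
  have h' : coroot M s v = cartan M s ⬝ᵥ v := rfl
  rw [refl_apply, dotProduct_sub, dotProduct_smul, sub_dotProduct, smul_dotProduct, h, h',
    smul_eq_mul, smul_eq_mul, mul_comm]

/-- The contragredient action of a word on a covector `x`, where `q s` is the coefficient that is
used when the letter `s` acts. -/
theorem dotProduct_geomRep_wordProd (x q : B → ℝ) (l : List B)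
    (h : ∀ l₁ s l₂, l = l₁ ++ s :: l₂ → x s - (l₁.map fun t => q t * cartan M t s).sum = q s)
    (v : B → ℝ) :
    x ⬝ᵥ geomRep cs (cs.wordProd l) v =
      (fun s => x s - (l.map fun t => q t * cartan M t s).sum) ⬝ᵥ v := by
  induction l generalizing x with
  | nil => simp
  | cons r l ih =>
    have hr : x r = q r := by simpa using h [] r l rfl
    rw [wordProd_cons, map_mul, Module.End.mul_apply, geomRep_simple, dotProduct_refl, hr, ih]
    · congr 1
      ext s
      simp [sub_sub]
    · intro l₁ s l₂ e
      have := h (r :: l₁) s l₂ (by rw [e, List.cons_append])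
      simpa [sub_sub] using this

theorem blockCovector_dotProduct_block {χ : B → ℤ} {p : B → ℝ} {g : ℕ → ℝ} {μ : ℝ}
    (hχ : ∀ s t, s ≠ t → Even (χ s + χ t) → cartan M s t = 0)
    (hp : ∀ s, coroot M s p = (2 - μ) * p s)
    (hg : ∀ k, g k + g (k + 2) = μ * g (k + 1)) (k : ℕ) (v : B → ℝ) :
    blockCovector χ p g k ⬝ᵥ geomRep cs (cs.wordProd (block χ (k + 1))) v =
      blockCovector χ p g (k + 1) ⬝ᵥ v := by
  rw [dotProduct_geomRep_wordProd cs _ fun s => p s * g (k + 1)]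
  · congr 1
    ext s
    rw [block, Finset.sum_map_toList]
    have hev : Even (χ s + (k + 1 + 1 : ℕ)) ↔ ¬ Even (χ s + (k + 1 : ℕ)) := by
      rw [Nat.cast_succ (k + 1), ← add_assoc, Int.even_add_one]
    by_cases hs : Even (χ s + (k + 1 : ℕ))
    · rw [Finset.sum_eq_single_of_mem s (by simpa using hs)]
      · simp only [blockCovector, hev, hs, not_true, if_true, if_false, cartan_self]
        ring
      · intro t ht hts
        rw [Finset.mem_filter] at ht
        rw [hχ t s hts, mul_zero]
        have := ht.2.add hs
        grind
    · have hsum : ∑ t with Even (χ t + (k + 1 : ℕ)), cartan M s t * p t = -μ * p s := by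
        have h1 := hp s
        rw [coroot_apply, ← Finset.sum_filter_add_sum_filter_not _
          fun t => Even (χ t + (k + 1 : ℕ))] at h1
        have h2 : ∑ t with ¬ Even (χ t + (k + 1 : ℕ)), cartan M s t * p t = 2 * p s := by
          rw [Finset.sum_eq_single_of_mem s (by simpa using hs), cartan_self]
          intro t ht hts
          rw [Finset.mem_filter] at ht
          rw [hχ s t hts.symm, zero_mul]
          have := (Int.not_even_iff_odd.1 ht.2).add_odd (Int.not_even_iff_odd.1 hs)
          grind
        linarith
      have h3 : ∑ t with Even (χ t + (k + 1 : ℕ)), p t * g (k + 1) * cartan M t s =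
          g (k + 1) * (-μ * p s) := by
        rw [← hsum, Finset.mul_sum]
        exact Finset.sum_congr rfl fun t _ => by rw [cartan_comm]; ring
      rw [h3]
      simp only [blockCovector, hev, hs, not_false_iff, if_true, if_false]
      linear_combination (-p s) * hg k
  · intro l₁ s l₂ e
    have hs : s ∈ block χ (k + 1) := by rw [e]; simp
    have hnd := nodup_block χ (k + 1)
    rw [e, List.nodup_append] at hnd
    have hz : (l₁.map fun t => p t * g (k + 1) * cartan M t s).sum = 0 := by
      refine List.sum_eq_zero fun y hy => ?_
      obtain ⟨t, ht, rfl⟩ := List.mem_map.1 hy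
      have ht' : t ∈ block χ (k + 1) := by rw [e]; simp [ht]
      rw [hχ t s (hnd.2.2 t ht s (by simp)), mul_zero]
      have := (mem_block.1 ht').add (mem_block.1 hs)
      grind
    rw [hz, sub_zero, blockCovector, if_pos (mem_block.1 hs)]

theorem blockCovector_dotProduct {χ : B → ℤ} {p : B → ℝ} {g : ℕ → ℝ} {μ : ℝ}
    (hχ : ∀ s t, s ≠ t → Even (χ s + χ t) → cartan M s t = 0)
    (hp : ∀ s, coroot M s p = (2 - μ) * p s)
    (hg : ∀ k, g k + g (k + 2) = μ * g (k + 1)) (k : ℕ) (v : B → ℝ) :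
    blockCovector χ p g 0 ⬝ᵥ geomRep cs (cs.wordProd (blockWord χ k)) v =
      blockCovector χ p g k ⬝ᵥ v := by
  induction k generalizing v with
  | zero => simp [blockWord]
  | succ k ih =>
    rw [blockWord, wordProd_append, map_mul, Module.End.mul_apply, ih,
      blockCovector_dotProduct_block cs hχ hp hg]

/-- The covectors on which a Coxeter element acts by shifting `G` by two. -/
noncomputable def coxeterCovector (M : CoxeterMatrix B) (l : List B) (τ : B → ℤ) (p : B → ℝ)
    (G : ℤ → ℝ) (s : B) : ℝ :=
  p s * G (τ s) + ∑ t with l.idxOf t < l.idxOf s, p t * G (τ t) * cartan M t s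

theorem coxeterCovector_dotProduct {l : List B} (hnd : l.Nodup) (hl : ∀ s, s ∈ l) {τ : B → ℤ}
    {p : B → ℝ} {G : ℤ → ℝ} {μ : ℝ}
    (hτ : ∀ s t, l.idxOf s < l.idxOf t → cartan M s t ≠ 0 → τ t = τ s + 1)
    (hp : ∀ s, coroot M s p = (2 - μ) * p s)
    (hG : ∀ k, G k + G (k + 2) = μ * G (k + 1)) (v : B → ℝ) :
    coxeterCovector M l τ p G ⬝ᵥ geomRep cs (cs.wordProd l) v =
      coxeterCovector M l τ p (fun k => G (k + 2)) ⬝ᵥ v := by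
  have hlt : ∀ s, ∑ t with l.idxOf t < l.idxOf s, p t * G (τ t + 2) * cartan M t s =
      G (τ s + 1) * ∑ t with l.idxOf t < l.idxOf s, cartan M s t * p t := by
    intro s
    rw [Finset.mul_sum]
    refine Finset.sum_congr rfl fun t ht => ?_
    rw [cartan_comm]
    by_cases h0 : cartan M s t = 0
    · rw [h0]; ring
    · rw [hτ t s (Finset.mem_filter.1 ht).2 (by rwa [cartan_comm])]
      rw [show τ t + 1 + 1 = τ t + 2 by ring]; ring
  have hgt : ∀ s, ∑ t with l.idxOf s < l.idxOf t, p t * G (τ t) * cartan M t s =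
      G (τ s + 1) * ∑ t with l.idxOf s < l.idxOf t, cartan M s t * p t := by
    intro s
    rw [Finset.mul_sum]
    refine Finset.sum_congr rfl fun t ht => ?_
    rw [cartan_comm]
    by_cases h0 : cartan M s t = 0
    · rw [h0]; ring
    · rw [hτ s t (Finset.mem_filter.1 ht).2 h0]; ring
  have hsplit : ∀ (s : B) (F : B → ℝ), ∑ t, F t =
      F s + ∑ t with l.idxOf t < l.idxOf s, F t + ∑ t with l.idxOf s < l.idxOf t, F t := by
    intro s F
    rw [← Finset.add_sum_erase _ _ (Finset.mem_univ s), add_assoc, ← Finset.sum_union]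
    · congr 1
      refine Finset.sum_congr ?_ fun _ _ => rfl
      ext t
      have : l.idxOf t = l.idxOf s ↔ t = s := List.idxOf_inj (hl t)
      simp only [Finset.mem_erase, Finset.mem_univ, Finset.mem_union, Finset.mem_filter, true_and,
        and_true]
      rw [ne_eq, ← this]
      omega
    · rw [Finset.disjoint_filter]
      intro t _ h1 h2
      omega
  rw [dotProduct_geomRep_wordProd cs _ fun s => p s * G (τ s)]
  · congr 1
    ext s
    have h1 := hp s
    rw [coroot_apply, hsplit s, cartan_self] at h1
    rw [← List.sum_toFinset _ hnd, show l.toFinset = Finset.univ from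
      Finset.eq_univ_iff_forall.2 fun s => List.mem_toFinset.2 (hl s), hsplit s, hgt]
    simp only [coxeterCovector]
    rw [hlt, cartan_self]
    linear_combination (-p s) * hG (τ s) - G (τ s + 1) * h1
  · intro l₁ s l₂ e
    have hs : s ∉ l₁ := by
      rw [e, List.nodup_append] at hnd
      exact fun h => hnd.2.2 s h s (by simp) rfl
    have hnd₁ : l₁.Nodup := by
      rw [e, List.nodup_append] at hnd
      exact hnd.1
    have hset : (Finset.univ.filter fun t => l.idxOf t < l.idxOf s) = l₁.toFinset := by
      ext t
      have hs' : l.idxOf s = l₁.length := by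
        rw [e, List.idxOf_append_of_notMem hs]; simp
      rw [Finset.mem_filter, List.mem_toFinset, hs']
      by_cases ht : t ∈ l₁
      · have := List.idxOf_lt_length_of_mem ht
        simp [ht, e, List.idxOf_append_of_mem ht, this]
      · simp [ht, e, List.idxOf_append_of_notMem ht]
    rw [coxeterCovector, hset, List.sum_toFinset _ hnd₁]
    ring

end

section

/-- `u` is the product of a subword of `ω`. -/
def IsSubwordProd (ω : List B) (u : W) : Prop := ∃ τ : List B, τ.Sublist ω ∧ cs.wordProd τ = u

variable {cs}

theorem rweakLE.isRightDescent {x y : W} {s : B} (h : rweakLE cs x y)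
    (hs : cs.IsRightDescent (x⁻¹ * y) s) :
    cs.IsRightDescent y s ∧ rweakLE cs x (y * cs.simple s) := by
  have h1 : cs.length (x⁻¹ * y * cs.simple s) + 1 = cs.length (x⁻¹ * y) :=
    cs.isRightDescent_iff.1 hs
  have h2 := cs.length_mul_le x (x⁻¹ * (y * cs.simple s))
  rw [mul_inv_cancel_left] at h2
  rw [mul_assoc] at h1
  have hd : cs.IsRightDescent y s := by
    unfold rweakLE at h
    unfold IsRightDescent
    omega
  have h3 : cs.length (y * cs.simple s) + 1 = cs.length y := cs.isRightDescent_iff.1 hd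
  refine ⟨hd, ?_⟩
  unfold rweakLE at h ⊢
  omega

theorem rweakLE.isRightDescent_inv_mul {x y : W} {s : B} (h : rweakLE cs x y)
    (hs : cs.IsRightDescent y s) (h' : rweakLE cs x (y * cs.simple s)) :
    cs.IsRightDescent (x⁻¹ * y) s := by
  unfold rweakLE at h h'
  unfold IsRightDescent at hs ⊢
  rw [mul_assoc]
  omega

theorem Compulsive.map_one {f : W → W} (hf : Compulsive cs f) : f 1 = 1 := by
  have h := (hf 1).1
  unfold rweakLE at h
  rw [length_one] at h
  exact cs.length_eq_zero_iff.1 (by omega)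

variable [Fintype B]

theorem IsSubwordProd.mul_simple {ω : List B} {u : W} (hu : IsSubwordProd cs ω u) {s : B}
    (hs : cs.IsRightDescent u s) : IsSubwordProd cs ω (u * cs.simple s) := by
  classical
  obtain ⟨τ, hτ, rfl⟩ := hu
  obtain ⟨τ', hτ', e⟩ := exists_sublist_of_isRightDescent cs hs
  exact ⟨τ', hτ'.trans hτ, e⟩

theorem IsSubwordProd.of_rweakLE {ω : List B} {u v : W} (hv : IsSubwordProd cs ω v)
    (h : rweakLE cs u v) : IsSubwordProd cs ω u := by
  induction hn : cs.length v using Nat.strong_induction_on generalizing v with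
  | _ n ih =>
    by_cases h1 : u⁻¹ * v = 1
    · rwa [inv_mul_eq_one.1 h1]
    · obtain ⟨s, hs⟩ := cs.exists_rightDescent_of_ne_one h1
      obtain ⟨hd, h'⟩ := h.isRightDescent hs
      exact ih _ (hn ▸ hd) (hv.mul_simple hd) h' rfl

theorem IsSubwordProd.of_concat {ω : List B} {t : B} {u : W} (hu : IsSubwordProd cs (ω ++ [t]) u) :
    (cs.IsRightDescent u t → IsSubwordProd cs ω (u * cs.simple t)) ∧
      (¬ cs.IsRightDescent u t → IsSubwordProd cs ω u) := by
  obtain ⟨τ, hτ, rfl⟩ := hu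
  obtain ⟨τ₁, τ₂, rfl, h₁, h₂⟩ := List.sublist_append_iff.1 hτ
  have hw : IsSubwordProd cs ω (cs.wordProd τ₁) := ⟨τ₁, h₁, rfl⟩
  rcases List.sublist_singleton.1 h₂ with rfl | rfl
  · rw [List.append_nil]
    exact ⟨hw.mul_simple, fun _ => hw⟩
  · rw [wordProd_append, wordProd_singleton]
    refine ⟨fun _ => by rwa [simple_mul_simple_cancel_right], fun h => hw.mul_simple ?_⟩
    rwa [isRightDescent_iff_not_isRightDescent_mul]

theorem isRightDescent_mul_simple_iff {s t : B} (h : cartan M t s = 0) (w : W) :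
    cs.IsRightDescent (w * cs.simple t) s ↔ cs.IsRightDescent w s := by
  classical
  rw [isRightDescent_iff_root_nonpos, isRightDescent_iff_root_nonpos, map_mul,
    Module.End.mul_apply, geomRep_simple, refl_root, h, zero_smul, sub_zero]

theorem IsSubwordProd.of_append {ω b : List B} (hb : b.Pairwise fun s t => cartan M s t = 0)
    {u v : W} (hv : IsSubwordProd cs (ω ++ b) v) (huv : rweakLE cs u v)
    (h : ∀ s ∈ b, cs.IsRightDescent v s → rweakLE cs u (v * cs.simple s)) :
    IsSubwordProd cs ω u := by
  induction b using List.reverseRecOn generalizing v with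
  | nil => exact (by simpa using hv : IsSubwordProd cs ω v).of_rweakLE huv
  | append_singleton b t ih =>
    rw [List.pairwise_append] at hb
    rw [← List.append_assoc] at hv
    by_cases ht : cs.IsRightDescent v t
    · have hut := h t (by simp) ht
      refine ih hb.1 (hv.of_concat.1 ht) hut fun s hs hsd => ?_
      have hst : cartan M t s = 0 := by rw [cartan_comm]; exact hb.2.2 s hs t (by simp)
      rw [isRightDescent_mul_simple_iff hst] at hsd
      refine (hut.isRightDescent ?_).2
      rw [← mul_assoc, isRightDescent_mul_simple_iff hst]
      exact huv.isRightDescent_inv_mul hsd (h s (by simp [hs]) hsd)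
    · exact ih hb.1 (hv.of_concat.2 ht) huv fun s hs => h s (by simp [hs])

/-- If every simple reflection is a descent of the product of `ω`, every element is the product of
a subword of `ω`. -/
theorem isSubwordProd_of_forall_isRightDescent {ω : List B}
    (h : ∀ s, cs.IsRightDescent (cs.wordProd ω) s) (u : W) : IsSubwordProd cs ω u := by
  classical
  have hneg : ∀ v : B → ℝ, 0 ≤ v → geomRep cs (cs.wordProd ω) v ≤ 0 := by
    intro v hv
    rw [← sum_smul_root v, map_sum]
    refine Finset.sum_nonpos fun s _ => ?_
    rw [map_smul]
    exact smul_nonpos_of_nonneg_of_nonpos (hv s) (geomRep_root_nonpos cs (h s))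
  suffices ∀ v, IsSubwordProd cs ω (cs.wordProd ω * v) by
    simpa using this ((cs.wordProd ω)⁻¹ * u)
  intro v
  induction hn : cs.length v using Nat.strong_induction_on generalizing v with
  | _ n ih =>
    by_cases h1 : v = 1
    · exact ⟨ω, List.Sublist.refl ω, by simp [h1]⟩
    · obtain ⟨s, hs⟩ := cs.exists_rightDescent_of_ne_one h1
      have h2 := (ih _ (hn ▸ hs) (v * cs.simple s) rfl).mul_simple (s := s) (by
        rw [isRightDescent_iff_root_nonpos, map_mul, Module.End.mul_apply]
        refine hneg _ (geomRep_root_nonneg cs ?_)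
        rwa [← isRightDescent_iff_not_isRightDescent_mul])
      rwa [← mul_assoc, simple_mul_simple_cancel_right] at h2

theorem pairwise_block {χ : B → ℤ} (hχ : ∀ s t, s ≠ t → Even (χ s + χ t) → cartan M s t = 0)
    (k : ℕ) : (block χ k).Pairwise fun s t => cartan M s t = 0 := by
  refine (nodup_block χ k).imp_of_mem fun {s t} hs ht hst => hχ s t hst ?_
  have := (mem_block.1 hs).add (mem_block.1 ht)
  grind

theorem Compulsive.isSubwordProd_iterate {f : W → W} (hf : Compulsive cs f) {χ : B → ℤ}
    (hχ : ∀ s t, s ≠ t → Even (χ s + χ t) → cartan M s t = 0) (k j : ℕ) {w : W}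
    (hw : IsSubwordProd cs (blockWord χ (k + j)) w) :
    IsSubwordProd cs (blockWord χ k) (f^[j] w) := by
  induction j generalizing w with
  | zero => exact hw
  | succ j ih =>
    exact ih (IsSubwordProd.of_append (pairwise_block hχ _) hw (hf w).1 fun s _ => (hf w).2 s)

theorem geomRep_wordProd_apply_of_notMem [DecidableEq B] {τ : List B} {r : B} (hr : r ∉ τ)
    (v : B → ℝ) : geomRep cs (cs.wordProd τ) v r = v r := by
  induction τ with
  | nil => simp
  | cons s τ ih =>
    rw [List.mem_cons, not_or] at hr
    rw [wordProd_cons, map_mul, Module.End.mul_apply, geomRep_simple, refl_apply_of_ne hr.1,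
      ih hr.2]

theorem eq_one_of_isSubwordProd {ω₁ ω₂ : List B} (hdisj : ω₁.Disjoint ω₂) {u : W}
    (h₁ : IsSubwordProd cs ω₁ u) (h₂ : IsSubwordProd cs ω₂ u) : u = 1 := by
  classical
  obtain ⟨τ₁, hτ₁, rfl⟩ := h₁
  obtain ⟨τ₂, hτ₂, e⟩ := h₂
  refine geomRep_injective cs (LinearMap.ext fun v => funext fun r => ?_)
  rw [map_one, Module.End.one_apply]
  by_cases hr : r ∈ τ₁
  · rw [← e]
    exact geomRep_wordProd_apply_of_notMem (fun h => hdisj (hτ₁.subset hr) (hτ₂.subset h)) v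
  · exact geomRep_wordProd_apply_of_notMem hr v

end

section

theorem exists_two_le_mul_eq_pi {θ : ℝ} (h0 : 0 < θ) (h1 : θ ≤ Real.pi / 2)
    (h : ∀ k : ℕ, 0 ≤ Real.sin ((k + 1) * θ) * Real.sin (k * θ)) :
    ∃ m : ℕ, 2 ≤ m ∧ m * θ = Real.pi := by
  have hpi := Real.pi_pos
  have hle : Real.pi ≤ (⌈Real.pi / θ⌉₊ : ℝ) * θ := (div_le_iff₀ h0).1 (Nat.le_ceil _)
  have hlt : (⌈Real.pi / θ⌉₊ : ℝ) * θ < Real.pi + θ := by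
    have := Nat.ceil_lt_add_one (div_pos hpi h0).le
    rw [← sub_lt_iff_lt_add, lt_div_iff₀ h0] at this
    linarith
  set m := ⌈Real.pi / θ⌉₊
  have hm : 2 ≤ m := by
    by_contra hm
    have : (m : ℝ) ≤ 1 := by exact_mod_cast (by omega : m ≤ 1)
    nlinarith
  refine ⟨m, hm, le_antisymm (not_lt.1 fun hgt => ?_) hle⟩
  obtain ⟨k, hk⟩ : ∃ k, m = k + 1 := ⟨m - 1, by omega⟩
  have hk' : (m : ℝ) = k + 1 := by exact_mod_cast hk
  have hk1 : (1 : ℝ) ≤ k := by exact_mod_cast (by omega : 1 ≤ k)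
  have hs1 : Real.sin ((k + 1) * θ) < 0 := by
    rw [← hk', ← neg_pos, ← Real.sin_sub_pi]
    exact Real.sin_pos_of_pos_of_lt_pi (by linarith) (by linarith)
  have hs2 : 0 < Real.sin (k * θ) := by
    rw [hk'] at hlt
    exact Real.sin_pos_of_pos_of_lt_pi (by positivity) (by linarith)
  have := h k
  nlinarith

theorem sin_recurrence (a θ : ℝ) :
    Real.sin a + Real.sin (a + 2 * θ) = 2 * Real.cos θ * Real.sin (a + θ) := by
  rw [show a = a + θ - θ by ring, show a + θ - θ + 2 * θ = a + θ + θ by ring, Real.sin_sub,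
    Real.sin_add (a + θ)]
  ring_nf

theorem cos_recurrence (a θ : ℝ) :
    Real.cos a + Real.cos (a + 2 * θ) = 2 * Real.cos θ * Real.cos (a + θ) := by
  rw [show a = a + θ - θ by ring, show a + θ - θ + 2 * θ = a + θ + θ by ring, Real.cos_sub,
    Real.cos_add (a + θ)]
  ring_nf

theorem blockCovector_zero_sin_nonneg {χ : B → ℤ} {p : B → ℝ} {θ a : ℝ} (hp : ∀ s, 0 < p s)
    (h₀ : 0 ≤ Real.sin (-a)) (h₁ : 0 ≤ Real.sin (θ + a)) :
    0 ≤ blockCovector χ p (fun k => Real.sin (k * θ + a)) 0 := by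
  intro s
  refine mul_nonneg (hp s).le ?_
  split_ifs
  · simpa using h₁
  · simpa using h₀

variable [Fintype B] [DecidableEq B]

variable {χ : B → ℤ} {p : B → ℝ} {θ : ℝ}

theorem blockCovector_sin_dotProduct
    (hχ : ∀ s t, s ≠ t → Even (χ s + χ t) → cartan M s t = 0)
    (hp : ∀ s, coroot M s p = (2 - 2 * Real.cos θ) * p s) (a : ℝ) (k : ℕ) (s : B) :
    blockCovector χ p (fun k => Real.sin (k * θ + a)) 0 ⬝ᵥ
        geomRep cs (cs.wordProd (blockWord χ k)) (root s) =
      blockCovector χ p (fun k => Real.sin (k * θ + a)) k s := by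
  rw [blockCovector_dotProduct cs hχ hp]
  · simp [root]
  · intro k
    convert sin_recurrence (k * θ + a) θ using 3 <;> push_cast <;> ring

theorem sin_mul_sin_nonneg (cs : CoxeterSystem M W)
    (hχ : ∀ s t, s ≠ t → Even (χ s + χ t) → cartan M s t = 0)
    (hp : ∀ s, coroot M s p = (2 - 2 * Real.cos θ) * p s) (hp0 : ∀ s, 0 < p s) (h0 : 0 < θ)
    (h1 : θ ≤ Real.pi / 2) {s : B} {k : ℕ} (hs : Even (χ s + (k + 1 : ℕ))) :
    0 ≤ Real.sin ((k + 1) * θ) * Real.sin (k * θ) := by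
  have hsin : 0 ≤ Real.sin θ := Real.sin_nonneg_of_nonneg_of_le_pi h0.le (by linarith)
  have hA := blockCovector_sin_dotProduct cs hχ hp 0 k s
  have hB := blockCovector_sin_dotProduct cs hχ hp (-θ) k s
  have hA0 : 0 ≤ blockCovector χ p (fun k => Real.sin (k * θ + 0)) 0 :=
    blockCovector_zero_sin_nonneg hp0 (by simp) (by simpa using hsin)
  have hB0 : 0 ≤ blockCovector χ p (fun k => Real.sin (k * θ + -θ)) 0 :=
    blockCovector_zero_sin_nonneg hp0 (by simpa using hsin) (by simp)
  have hA1 : blockCovector χ p (fun k => Real.sin (k * θ + 0)) k s =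
      p s * Real.sin ((k + 1) * θ) := by
    rw [blockCovector, if_pos hs]; push_cast; ring_nf
  have hB1 : blockCovector χ p (fun k => Real.sin (k * θ + -θ)) k s = p s * Real.sin (k * θ) := by
    rw [blockCovector, if_pos hs]; push_cast; ring_nf
  rw [hA1] at hA
  rw [hB1] at hB
  by_cases hd : cs.IsRightDescent (cs.wordProd (blockWord χ k)) s
  · have hr : 0 ≤ -geomRep cs (cs.wordProd (blockWord χ k)) (root s) :=
      neg_nonneg.2 (geomRep_root_nonpos cs hd)
    have a1 := dotProduct_nonneg_of_nonneg hA0 hr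
    have b1 := dotProduct_nonneg_of_nonneg hB0 hr
    rw [dotProduct_neg, hA, neg_nonneg] at a1
    rw [dotProduct_neg, hB, neg_nonneg] at b1
    exact mul_nonneg_of_nonpos_of_nonpos (nonpos_of_mul_nonpos_right a1 (hp0 s))
      (nonpos_of_mul_nonpos_right b1 (hp0 s))
  · have hr := geomRep_root_nonneg cs hd
    have a1 := dotProduct_nonneg_of_nonneg hA0 hr
    have b1 := dotProduct_nonneg_of_nonneg hB0 hr
    rw [hA] at a1
    rw [hB] at b1
    exact mul_nonneg (nonneg_of_mul_nonneg_right a1 (hp0 s)) (nonneg_of_mul_nonneg_right b1 (hp0 s))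

theorem exists_mul_eq_pi [Nonempty B] (cs : CoxeterSystem M W)
    (hχ : ∀ s t, s ≠ t → Even (χ s + χ t) → cartan M s t = 0)
    (hp : ∀ s, coroot M s p = (2 - 2 * Real.cos θ) * p s) (hp0 : ∀ s, 0 < p s) (h0 : 0 < θ)
    (h1 : θ ≤ Real.pi / 2) : ∃ m : ℕ, 2 ≤ m ∧ m * θ = Real.pi := by
  refine exists_two_le_mul_eq_pi h0 h1 fun k => ?_
  by_cases hs : ∃ s, Even (χ s + (k + 1 : ℕ))
  · obtain ⟨s, hs⟩ := hs
    exact sin_mul_sin_nonneg cs hχ hp hp0 h0 h1 hs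
  · push Not at hs
    obtain ⟨s⟩ := ‹Nonempty B›
    have h2 := hp s
    rw [coroot_apply, Finset.sum_eq_single_of_mem s (Finset.mem_univ s), cartan_self] at h2
    · have hcos : Real.cos θ = 0 := by
        have := (hp0 s).ne'
        have h3 : p s * Real.cos θ = 0 := by linarith
        exact (mul_eq_zero.1 h3).resolve_left this
      rw [show θ = Real.pi / 2 from Real.injOn_cos ⟨h0.le, by linarith⟩
        ⟨by positivity, by linarith⟩ (by rw [hcos, Real.cos_pi_div_two]),
        show ((k : ℝ) + 1) * (Real.pi / 2) = k * (Real.pi / 2) + Real.pi / 2 by ring,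
        Real.sin_add_pi_div_two]
      have h4 := Real.sin_two_mul (k * (Real.pi / 2))
      rw [show 2 * ((k : ℝ) * (Real.pi / 2)) = k * Real.pi by ring, Real.sin_nat_mul_pi] at h4
      linarith
    · intro t _ hts
      rw [hχ s t hts.symm, zero_mul]
      have := (Int.not_even_iff_odd.1 (hs t)).add_odd (Int.not_even_iff_odd.1 (hs s))
      grind

theorem isRightDescent_blockWord (hχ : ∀ s t, s ≠ t → Even (χ s + χ t) → cartan M s t = 0)
    (hp : ∀ s, coroot M s p = (2 - 2 * Real.cos θ) * p s) (hp0 : ∀ s, 0 < p s) (h0 : 0 < θ)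
    {m : ℕ} (hm : 2 ≤ m) (hmθ : m * θ = Real.pi) (s : B) :
    cs.IsRightDescent (cs.wordProd (blockWord χ m)) s := by
  have hm' : (2 : ℝ) ≤ m := by exact_mod_cast hm
  have hsin : 0 < Real.sin θ := Real.sin_pos_of_pos_of_lt_pi h0 (by nlinarith)
  by_contra hd
  have hr := geomRep_root_nonneg cs hd
  by_cases hs : Even (χ s + (m + 1 : ℕ))
  · have h := dotProduct_nonneg_of_nonneg
      (blockCovector_zero_sin_nonneg (χ := χ) (a := 0) (θ := θ) hp0 (by simp)
        (by simpa using hsin.le)) hr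
    rw [blockCovector_sin_dotProduct cs hχ hp, blockCovector, if_pos hs] at h
    have h2 : Real.sin ((m + 1 : ℕ) * θ + 0) = -Real.sin θ := by
      rw [← Real.sin_add_pi, ← hmθ]; push_cast; ring_nf
    rw [h2] at h
    have := hp0 s
    nlinarith
  · have h := dotProduct_nonneg_of_nonneg
      (blockCovector_zero_sin_nonneg (χ := χ) (a := -θ) (θ := θ) hp0
        (by simpa using hsin.le) (by simp)) hr
    rw [blockCovector_sin_dotProduct cs hχ hp, blockCovector, if_neg hs] at h
    have h2 : Real.sin (m * θ + -θ) = Real.sin θ := by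
      rw [hmθ, ← sub_eq_add_neg, Real.sin_pi_sub]
    rw [h2] at h
    have := hp0 s
    nlinarith

theorem Compulsive.iterate_eq_one {cs : CoxeterSystem M W} {f : W → W} (hf : Compulsive cs f)
    (hχ : ∀ s t, s ≠ t → Even (χ s + χ t) → cartan M s t = 0)
    (hp : ∀ s, coroot M s p = (2 - 2 * Real.cos θ) * p s) (hp0 : ∀ s, 0 < p s) (h0 : 0 < θ)
    {m : ℕ} (hm : 2 ≤ m) (hmθ : m * θ = Real.pi) (w : W) : f^[m - 1] w = 1 := by
  have key : ∀ ψ : B → ℤ, (∀ s t, s ≠ t → Even (ψ s + ψ t) → cartan M s t = 0) →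
      IsSubwordProd cs (block ψ 1) (f^[m - 1] w) := by
    intro ψ hψ
    have h := hf.isSubwordProd_iterate hψ 1 (m - 1) (w := w) (by
      rw [Nat.add_sub_cancel' (by omega)]
      exact isSubwordProd_of_forall_isRightDescent
        (isRightDescent_blockWord cs hψ hp hp0 h0 hm hmθ) w)
    simpa [blockWord] using h
  refine eq_one_of_isSubwordProd (fun s h₁ h₂ => ?_) (key χ hχ)
    (key (fun s => χ s + 1) fun s t hst h => hχ s t hst (by grind))
  rw [mem_block] at h₁ h₂
  grind

theorem dvd_of_coxeter_pow_eq_one {l : List B} (hnd : l.Nodup) (hl : ∀ s, s ∈ l) {τ : B → ℤ}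
    (hne : l ≠ [])
    (hτ : ∀ s t, l.idxOf s < l.idxOf t → cartan M s t ≠ 0 → τ t = τ s + 1)
    (hp : ∀ s, coroot M s p = (2 - 2 * Real.cos θ) * p s) (hp0 : ∀ s, 0 < p s)
    {m : ℕ} (hmθ : m * θ = Real.pi) {h : ℕ} (hh : cs.wordProd l ^ h = 1) : m ∣ h := by
  obtain ⟨s, l', rfl⟩ := List.exists_cons_of_ne_nil hne
  set l := s :: l' with hl'
  have key : ∀ (n : ℕ) (G : ℤ → ℝ), (∀ k, G k + G (k + 2) = 2 * Real.cos θ * G (k + 1)) →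
      ∀ v, coxeterCovector M l τ p G ⬝ᵥ geomRep cs (cs.wordProd l ^ n) v =
        coxeterCovector M l τ p (fun k => G (k + 2 * n)) ⬝ᵥ v := by
    intro n
    induction n with
    | zero => simp
    | succ n ih =>
      intro G hG v
      rw [pow_succ', map_mul, Module.End.mul_apply, coxeterCovector_dotProduct cs hnd hl hτ hp hG,
        ih]
      · congr 2
        ext k
        push_cast
        ring_nf
      · intro k
        have := hG (k + 2)
        rwa [show k + 2 + 1 = k + 1 + 2 by ring] at this
  have h1 := key h (fun k => Real.cos ((k - τ s : ℤ) * θ)) (fun k => by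
    convert cos_recurrence ((k - τ s) * θ) θ using 3 <;> push_cast <;> ring) (root s)
  have hfirst : ∀ G : ℤ → ℝ, coxeterCovector M l τ p G ⬝ᵥ root s = p s * G (τ s) := by
    intro G
    simp [root, coxeterCovector, hl']
  rw [hh, map_one, Module.End.one_apply, hfirst, hfirst] at h1
  have h2 := mul_left_cancel₀ (hp0 s).ne' h1
  simp only [sub_self, Int.cast_zero, zero_mul, Real.cos_zero, add_sub_cancel_left] at h2
  obtain ⟨n, hn⟩ := (Real.cos_eq_one_iff _).1 h2.symm
  rw [← hmθ] at hn
  have hθ : θ ≠ 0 := by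
    rintro rfl
    rw [mul_zero] at hmθ
    exact Real.pi_ne_zero hmθ.symm
  have hn' : ((n * m : ℤ) : ℝ) = ((h : ℤ) : ℝ) := by
    push_cast at hn ⊢
    apply mul_right_cancel₀ hθ
    linarith
  exact Int.natCast_dvd_natCast.1 ⟨n, by rw [← Int.cast_injective hn', mul_comm]⟩

end

/-- if `W` is a finite irreducible Coxeter group with Coxeter number `h`
(the order of any Coxeter element) and `f` is compulsive, then `f^{h-1}(w) = e` for all
`w`; in particular every forward orbit under `f` has size at most `h`. -/
theorem compulsive_iterate_coxeterNumber [Finite W] (hirr : IsIrreducibleMatrix M)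
    (f : W → W) (hf : Compulsive cs f) (c : W)
    (hc : ∃ l : List B, l.Nodup ∧ (∀ i : B, i ∈ l) ∧ cs.wordProd l = c)
    (h : ℕ) (hh : h = orderOf c) (w : W) :
    f^[h - 1] w = 1 := by
  classical
  obtain ⟨l, hnd, hl, rfl⟩ := hc
  rcases isEmpty_or_nonempty B with hB | hB
  · obtain ⟨ω, hω⟩ := cs.wordProd_surjective (f^[h - 1] w)
    rw [← hω, (List.eq_nil_iff_forall_not_mem.2 fun s _ => hB.elim s : ω = []), wordProd_nil]
  let _ : Fintype B := ⟨l.toFinset, fun s => List.mem_toFinset.2 (hl s)⟩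
  have hpos : ∀ x : B → ℝ, x ≠ 0 → 0 < form M x x := fun x hx => form_self_pos cs hirr hx
  have htree := diagram_isTree hirr (hpos 1 one_ne_zero)
  obtain ⟨p, θ, hθ0, hθ1, hp0, hp⟩ := exists_perron hirr hpos
  obtain ⟨τ, hτ⟩ := exists_potential htree
    (fun s t => if l.idxOf s < l.idxOf t then 1 else if l.idxOf t < l.idxOf s then -1 else 0)
    (fun s t => by grind)
  have hχ : ∀ s t, s ≠ t → Even (τ s + τ t) → cartan M s t = 0 := by
    intro s t hst hev
    refine cartan_eq_zero_of_not_adj hst fun hadj => ?_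
    have h1 := hτ s t hadj
    have h2 : l.idxOf s ≠ l.idxOf t := fun e => hst ((List.idxOf_inj (hl s)).1 e)
    grind
  have hτ' : ∀ s t, l.idxOf s < l.idxOf t → cartan M s t ≠ 0 → τ t = τ s + 1 := by
    intro s t hlt hne
    have hst : s ≠ t := by rintro rfl; exact lt_irrefl _ hlt
    have hadj : (diagram M).Adj s t := by
      by_contra hadj
      exact hne (cartan_eq_zero_of_not_adj hst hadj)
    rw [hτ s t hadj, if_pos hlt]
  obtain ⟨m, hm, hmθ⟩ := exists_mul_eq_pi cs hχ hp hp0 hθ0 hθ1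
  have hlne : l ≠ [] := by
    obtain ⟨s⟩ := hB
    exact List.ne_nil_of_mem (hl s)
  have hdvd : m ∣ h :=
    dvd_of_coxeter_pow_eq_one cs hnd hl hlne hτ' hp hp0 hmθ (hh ▸ pow_orderOf_eq_one _)
  have hle : m ≤ h := Nat.le_of_dvd (hh ▸ orderOf_pos _) hdvd
  rw [show h - 1 = (h - m) + (m - 1) by omega, Function.iterate_add_apply,
    hf.iterate_eq_one hχ hp hp0 hθ0 hm hmθ, Function.iterate_fixed hf.map_one]

end CoxPop
end

section
/- If W is an infinite irreducible Coxeter group with finitely many simple generators, then the forward orbit sizes of elements of W under the Coxeter pop-stack-sorting operator Pop are unbounded: for every N there exists w ∈ W with |O_Pop(w)| ≥ N. -/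
namespace CoxPop

variable {B W : Type*} [Group W] {M : CoxeterMatrix B} (cs : CoxeterSystem M W)

open Classical in
/-- The action of the simple reflection `s i` on `W × ℤ/2`: conjugation by `s i` on the first
factor, flipping the sign exactly over `s i`. -/
noncomputable def signedConj (i : B) : Function.End (W × ZMod 2) := fun p =>
  (cs.simple i * p.1 * cs.simple i, p.2 + if p.1 = cs.simple i then 1 else 0)

open Classical in
theorem signedConj_mul_pow_apply (i j : B) (k : ℕ) (t : W) (e : ZMod 2) :
    ((signedConj cs i * signedConj cs j) ^ k) (t, e) =
      ((cs.simple i * cs.simple j) ^ k * t * ((cs.simple i * cs.simple j) ^ k)⁻¹,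
        e + ∑ l ∈ Finset.range (2 * k),
          if t = cs.simple j * (cs.simple i * cs.simple j) ^ l then 1 else 0) := by
  have hcomm (k : ℕ) : ((cs.simple i * cs.simple j) ^ k)⁻¹ * cs.simple j =
      cs.simple j * (cs.simple i * cs.simple j) ^ k := by
    induction k with
    | zero => simp
    | succ k ih =>
      rw [pow_succ, mul_inv_rev, mul_assoc, ih, ← mul_assoc, mul_inv_rev, cs.inv_simple,
        cs.inv_simple, ← pow_succ, pow_succ']
      simp only [mul_assoc]
  induction k with
  | zero => simp [Function.End.one_def]
  | succ k ih =>
    rw [pow_succ']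
    change signedConj cs i (signedConj cs j (((signedConj cs i * signedConj cs j) ^ k) (t, e))) = _
    rw [ih]
    have hfst : (cs.simple i * cs.simple j) ^ k * t * ((cs.simple i * cs.simple j) ^ k)⁻¹ =
        cs.simple j ↔ t = cs.simple j * (cs.simple i * cs.simple j) ^ (2 * k) := by
      rw [mul_inv_eq_iff_eq_mul, ← eq_inv_mul_iff_mul_eq, ← mul_assoc, hcomm, mul_assoc,
        ← pow_add, two_mul]
    have hsnd : cs.simple j * ((cs.simple i * cs.simple j) ^ k * t *
        ((cs.simple i * cs.simple j) ^ k)⁻¹) * cs.simple j = cs.simple i ↔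
        t = cs.simple j * (cs.simple i * cs.simple j) ^ (2 * k + 1) := by
      have h1 : cs.simple j * ((cs.simple i * cs.simple j) ^ k * t *
          ((cs.simple i * cs.simple j) ^ k)⁻¹) * cs.simple j = cs.simple i ↔
          (cs.simple i * cs.simple j) ^ k * t * ((cs.simple i * cs.simple j) ^ k)⁻¹ =
          cs.simple j * (cs.simple i * cs.simple j) := by
        conv_lhs => rw [← eq_mul_inv_iff_mul_eq, cs.inv_simple, ← eq_inv_mul_iff_mul_eq,
          cs.inv_simple]
      rw [h1, mul_inv_eq_iff_eq_mul, ← eq_inv_mul_iff_mul_eq, ← mul_assoc, ← mul_assoc, hcomm,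
        mul_assoc, mul_assoc, ← pow_succ', ← pow_add, two_mul, add_assoc]
    simp only [signedConj, hfst, hsnd, Prod.mk.injEq]
    constructor
    · rw [pow_succ']
      simp [mul_assoc]
    · rw [show 2 * (k + 1) = 2 * k + 1 + 1 by ring, Finset.sum_range_succ, Finset.sum_range_succ]
      ring

theorem isLiftable_signedConj : M.IsLiftable (signedConj cs) := by
  classical
  intro i j
  funext p
  obtain ⟨t, e⟩ := p
  rw [signedConj_mul_pow_apply, cs.simple_mul_simple_pow, two_mul, Finset.sum_range_add]
  simp only [pow_add, cs.simple_mul_simple_pow, one_mul, CharTwo.add_self_eq_zero]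
  simp [Function.End.one_def]

open Classical in
theorem lift_signedConj_wordProd (ω : List B) (t : W) (e : ZMod 2) :
    cs.lift ⟨signedConj cs, isLiftable_signedConj cs⟩ (cs.wordProd ω) (t, e) =
      (cs.wordProd ω * t * (cs.wordProd ω)⁻¹, e + ((cs.rightInvSeq ω).count t : ZMod 2)) := by
  induction ω with
  | nil => simp [Function.End.one_def]
  | cons i ω ih =>
    rw [cs.wordProd_cons, map_mul, cs.lift_apply_simple]
    change signedConj cs i (cs.lift ⟨signedConj cs, isLiftable_signedConj cs⟩
      (cs.wordProd ω) (t, e)) = _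
    rw [ih]
    have h : cs.wordProd ω * t * (cs.wordProd ω)⁻¹ = cs.simple i ↔
        (cs.wordProd ω)⁻¹ * cs.simple i * cs.wordProd ω = t := by
      rw [mul_inv_eq_iff_eq_mul, ← eq_inv_mul_iff_mul_eq, eq_comm, mul_assoc]
    simp only [signedConj, CoxeterSystem.rightInvSeq, List.count_cons, h, Prod.mk.injEq]
    constructor
    · simp [mul_assoc]
    · simp [add_assoc]

open Classical in
theorem count_rightInvSeq_eq_of_wordProd_eq {ω ω' : List B}
    (h : cs.wordProd ω = cs.wordProd ω') (t : W) :
    ((cs.rightInvSeq ω).count t : ZMod 2) = (cs.rightInvSeq ω').count t := by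
  have h1 := lift_signedConj_wordProd cs ω t 0
  rw [h, lift_signedConj_wordProd cs ω' t 0] at h1
  simpa using (congrArg Prod.snd h1).symm

/-- The exchange condition. -/
theorem exists_eraseIdx_of_isRightDescent (ω : List B) (i : B)
    (h : cs.IsRightDescent (cs.wordProd ω) i) :
    ∃ k < ω.length, cs.wordProd ω * cs.simple i = cs.wordProd (ω.eraseIdx k) := by
  classical
  obtain ⟨ω', hω', hw⟩ := cs.exists_isReduced (cs.wordProd ω * cs.simple i)
  have hprod : cs.wordProd (ω'.concat i) = cs.wordProd ω := by
    rw [cs.wordProd_concat, ← hw, cs.simple_mul_simple_cancel_right]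
  have hred : cs.IsReduced (ω'.concat i) := by
    rw [CoxeterSystem.IsReduced, hprod, List.length_concat, ← hω'.eq, ← hw]
    exact (cs.isRightDescent_iff.1 h).symm
  have hcount : (cs.rightInvSeq (ω'.concat i)).count (cs.simple i) = 1 :=
    List.count_eq_one_of_mem hred.nodup_rightInvSeq (by rw [cs.rightInvSeq_concat]; simp)
  have hmem : cs.simple i ∈ cs.rightInvSeq ω := by
    by_contra hn
    have := count_rightInvSeq_eq_of_wordProd_eq cs hprod (cs.simple i)
    rw [hcount, List.count_eq_zero_of_not_mem hn] at this
    simp at this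
  obtain ⟨k, hk, hki⟩ := List.mem_iff_getElem.mp hmem
  refine ⟨k, by simpa using hk, ?_⟩
  rw [← cs.wordProd_mul_getD_rightInvSeq, List.getD_eq_getElem _ 1 hk, hki]

theorem exists_word_of_mem_parabolic {J : Set B} {u : W} (hu : u ∈ parabolic cs J) :
    ∃ ω : List B, (∀ i ∈ ω, i ∈ J) ∧ cs.wordProd ω = u := by
  induction hu using Subgroup.closure_induction with
  | mem x hx =>
    obtain ⟨i, hi, rfl⟩ := hx
    exact ⟨[i], by simpa using hi, by simp⟩
  | one => exact ⟨[], by simp, by simp⟩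
  | mul x y _ _ hx hy =>
    obtain ⟨ω, hω, rfl⟩ := hx
    obtain ⟨ω', hω', rfl⟩ := hy
    refine ⟨ω ++ ω', ?_, cs.wordProd_append ω ω'⟩
    intro i hi
    exact (List.mem_append.1 hi).elim (hω i) (hω' i)
  | inv x _ hx =>
    obtain ⟨ω, hω, rfl⟩ := hx
    exact ⟨ω.reverse, by simpa using hω, by simp⟩

theorem exists_isReduced_of_mem_parabolic {J : Set B} {u : W} (hu : u ∈ parabolic cs J) :
    ∃ ω : List B, (∀ i ∈ ω, i ∈ J) ∧ cs.IsReduced ω ∧ cs.wordProd ω = u := by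
  obtain ⟨ω, hω, rfl⟩ := exists_word_of_mem_parabolic cs hu
  clear hu
  induction ω using List.reverseRecOn with
  | nil => exact ⟨[], by simp, by simp [CoxeterSystem.IsReduced], rfl⟩
  | append_singleton ω i ih =>
    obtain ⟨ω', hJ, hred, hprod⟩ := ih fun k hk => hω k (by simp [hk])
    rw [cs.wordProd_append, cs.wordProd_singleton, ← hprod]
    by_cases hd : cs.IsRightDescent (cs.wordProd ω') i
    · obtain ⟨k, hk, he⟩ := exists_eraseIdx_of_isRightDescent cs ω' i hd
      refine ⟨ω'.eraseIdx k, fun l hl => hJ l (List.mem_of_mem_eraseIdx hl), ?_, he.symm⟩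
      rw [cs.isRightDescent_iff, he, hred.eq] at hd
      rw [CoxeterSystem.IsReduced, List.length_eraseIdx_of_lt hk]
      omega
    · refine ⟨ω' ++ [i], ?_, ?_, by simp [cs.wordProd_append]⟩
      · intro k hk
        rcases List.mem_append.1 hk with hk | hk
        · exact hJ k hk
        · exact hω k (by simp_all)
      · rw [cs.not_isRightDescent_iff, hred.eq] at hd
        simpa [CoxeterSystem.IsReduced, cs.wordProd_append] using hd

theorem length_mul_inv_add_length {J : Set B} {w : W} (hw : J ⊆ D cs w) {u : W}
    (hu : u ∈ parabolic cs J) :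
    cs.length (w * u⁻¹) + cs.length u = cs.length w := by
  obtain ⟨ω, hω, hred, rfl⟩ := exists_isReduced_of_mem_parabolic cs hu
  clear hu
  induction ω using List.reverseRecOn with
  | nil => simp
  | append_singleton ω i ih =>
    have hred' : cs.IsReduced ω := by simpa using hred.take ω.length
    have ih := ih (fun k hk => hω k (by simp [hk])) hred'
    obtain ⟨ξ, hξ, hx⟩ := cs.exists_isReduced (w * (cs.wordProd ω)⁻¹)
    have hwprod : cs.wordProd (ξ ++ ω) = w := by
      rw [cs.wordProd_append, ← hx, inv_mul_cancel_right]
    obtain ⟨k, hk, he⟩ := exists_eraseIdx_of_isRightDescent cs (ξ ++ ω) i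
      (hwprod ▸ hw (hω i (by simp)))
    rw [hwprod] at he
    have hlow := cs.length_le_length_mul_add_right w (cs.wordProd (ω ++ [i]))⁻¹
    rw [cs.length_inv] at hlow
    have hlen := hred.eq
    rw [List.length_append, List.length_singleton] at hlen
    rw [hx, hξ.eq, hred'.eq] at ih
    have hsplit : w * (cs.wordProd (ω ++ [i]))⁻¹ = w * cs.simple i * (cs.wordProd ω)⁻¹ := by
      rw [cs.wordProd_append, cs.wordProd_singleton, mul_inv_rev, cs.inv_simple, mul_assoc]
    rcases lt_or_ge k ξ.length with hkξ | hkξ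
    · rw [List.eraseIdx_append_of_lt_length hkξ, cs.wordProd_append] at he
      rw [he, mul_inv_cancel_right] at hsplit
      have := cs.length_wordProd_le (ξ.eraseIdx k)
      rw [List.length_eraseIdx_of_lt hkξ] at this
      rw [hsplit] at hlow ⊢
      omega
    · rw [List.eraseIdx_append_of_length_le hkξ, cs.wordProd_append, ← hwprod,
        cs.wordProd_append, mul_assoc, mul_right_inj] at he
      have hk' : k - ξ.length < ω.length := by
        rw [List.length_append] at hk
        omega
      have := cs.length_wordProd_le (ω.eraseIdx (k - ξ.length))
      rw [List.length_eraseIdx_of_lt hk', ← he, ← cs.wordProd_singleton i,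
        ← cs.wordProd_append] at this
      omega

theorem isLongestIn_w0_of_subset_D {J : Set B} {w : W} (hw : J ⊆ D cs w) :
    IsLongestIn cs J (w0 cs J) := by
  have hex : ∃ u, IsLongestIn cs J u := by
    have hfin : (cs.length '' (parabolic cs J : Set W)).Finite :=
      (Set.finite_Iic (cs.length w)).subset <| by
        rintro _ ⟨u, hu, rfl⟩
        exact (length_mul_inv_add_length cs hw hu) ▸ Nat.le_add_left _ _
    obtain ⟨_, ⟨u, hu, rfl⟩, hmax⟩ := Set.exists_max_image _ id hfin
      ⟨_, 1, (parabolic cs J).one_mem, rfl⟩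
    exact ⟨u, hu, fun v hv => hmax _ ⟨v, hv, rfl⟩⟩
  rw [w0, dif_pos hex]
  exact hex.choose_spec

theorem length_Pop_add (w : W) :
    cs.length (Pop cs w) + cs.length (w0 cs (D cs w)) = cs.length w := by
  have hmem := (isLongestIn_w0_of_subset_D cs (subset_refl (D cs w))).1
  simpa [Pop] using length_mul_inv_add_length cs subset_rfl (inv_mem hmem)

theorem length_Pop_lt {w : W} (hw : w ≠ 1) : cs.length (Pop cs w) < cs.length w := by
  obtain ⟨i, hi⟩ := cs.exists_rightDescent_of_ne_one hw
  have hlong := (isLongestIn_w0_of_subset_D cs (subset_refl (D cs w))).2 (cs.simple i)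
    (Subgroup.subset_closure ⟨i, hi, rfl⟩)
  rw [cs.length_simple] at hlong
  have := length_Pop_add cs w
  omega

theorem exists_lt_length [Finite B] [Infinite W] (n : ℕ) : ∃ w : W, n < cs.length w := by
  by_contra! h
  refine Set.infinite_univ (α := W) (((List.finite_length_le B n).image cs.wordProd).subset ?_)
  intro w _
  obtain ⟨ω, hω, rfl⟩ := cs.exists_isReduced w
  exact ⟨ω, by simpa [← hω.eq] using h (cs.wordProd ω), rfl⟩

/-- if `W` is an infinite irreducible Coxeter group with finitely many
simple generators, then forward orbits under `Pop` are unbounded in size: for every `N`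
there is an element whose first `N` iterates under `Pop` are pairwise distinct. -/
theorem pop_orbits_unbounded [Finite B] [Infinite W] (hirr : IsIrreducibleMatrix M) (N : ℕ) :
    ∃ w : W, Function.Injective (fun k : Fin N => (Pop cs)^[k] w) := by
  obtain ⟨C, hC⟩ := (Set.finite_range fun J : Set B => cs.length (w0 cs J)).bddAbove
  obtain ⟨w, hw⟩ := exists_lt_length cs (N * C)
  have hlow (k : ℕ) : cs.length w ≤ cs.length ((Pop cs)^[k] w) + k * C := by
    induction k with
    | zero => simp
    | succ k ih =>
      have hadd := length_Pop_add cs ((Pop cs)^[k] w)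
      have hle : cs.length (w0 cs (D cs ((Pop cs)^[k] w))) ≤ C := hC ⟨_, rfl⟩
      rw [Function.iterate_succ_apply', add_mul]
      omega
  have hstep (k : ℕ) (hk : k < N) :
      cs.length ((Pop cs)^[k + 1] w) < cs.length ((Pop cs)^[k] w) := by
    rw [Function.iterate_succ_apply']
    apply length_Pop_lt
    rw [Ne, ← cs.length_eq_zero_iff]
    have := Nat.mul_le_mul_right C hk.le
    have := hlow k
    omega
  have hanti (a b : ℕ) (hab : a < b) (hb : b < N) :
      cs.length ((Pop cs)^[b] w) < cs.length ((Pop cs)^[a] w) := by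
    induction b, hab using Nat.le_induction with
    | base => exact hstep a (by omega)
    | succ b _ ih => exact (hstep b (by omega)).trans (ih (by omega))
  refine ⟨w, fun a b hab => ?_⟩
  have hlen := congrArg cs.length hab
  rcases lt_trichotomy a b with h | h | h
  · exact absurd hlen (hanti a b h b.2).ne'
  · exact h
  · exact absurd hlen (hanti b a h a.2).ne

end CoxPop
end
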